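/- (Hörmander–Łojasiewicz division.) Let U ⊆ ℝ^n be open, φ : U → ℝ real-analytic, and f : U → ℝ C^∞. Then there exists g ∈ C^∞(U) with f = g·φ on U if and only if for every a ∈ U there exists a formal power series G_a ∈ ℝ[[x_1,…,x_n]] with T_a f = G_a·T_a φ. -/

import Mathlib

namespace QDC

/-- `M` is a sequence defining a quasianalytic Denjoy–Carleman class: positive,
logarithmically convex, with `sup_k (M_{k+1}/M_k)^{1/k} < ∞` and
`Σ_k M_k/((k+1) M_{k+1}) = ∞`. -/
def IsDCSeq (M : ℕ → ℝ) : Prop :=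
  (∀ k, 0 < M k) ∧
  (∀ k, M (k + 1) / M k ≤ M (k + 2) / M (k + 1)) ∧
  (∃ C : ℝ, ∀ k : ℕ, 1 ≤ k → (M (k + 1) / M k) ^ ((1 : ℝ) / k) ≤ C) ∧
  ¬ Summable (fun k => M k / ((k + 1) * M (k + 1)))

variable {σ : Type*} [Fintype σ] [DecidableEq σ]

/-- First-order partial derivative in the `i`-th coordinate direction. -/
noncomputable def pd (i : σ) (f : (σ → ℝ) → ℝ) : (σ → ℝ) → ℝ :=
  fun x => fderiv ℝ f x (Pi.single i 1)

/-- Iterated partial derivative `∂^{|α|} f / ∂x^α` for a multi-index `α`. -/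
noncomputable def mpd (α : σ → ℕ) (f : (σ → ℝ) → ℝ) : (σ → ℝ) → ℝ :=
  (Finset.univ : Finset σ).toList.foldr (fun i g => (pd i)^[α i] g) f

/-- `α! = α_1! ⋯ α_n!`. -/
def mfact (α : σ → ℕ) : ℕ := ∏ i, (α i).factorial

/-- `|α| = α_1 + ⋯ + α_n`. -/
def mdeg (α : σ → ℕ) : ℕ := ∑ i, α i

/-- `f` belongs to the Denjoy–Carleman class `Q_M(V)`. -/
def MemDC (M : ℕ → ℝ) (V : Set (σ → ℝ)) (f : (σ → ℝ) → ℝ) : Prop :=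
  ContDiffOn ℝ (⊤ : ℕ∞) f V ∧
  ∀ K ⊆ V, IsCompact K → ∃ A B : ℝ, 0 < A ∧ 0 < B ∧
    ∀ x ∈ K, ∀ α : σ → ℕ,
      |mpd α f x| ≤ A * B ^ mdeg α * (mfact α : ℝ) * M (mdeg α)

/-- `X` is a closed `Q_M`-subset of the open set `U`: it is closed in `U` and locally
the common zero set of finitely many functions of class `Q_M`. -/
def IsQMClosed (M : ℕ → ℝ) {n : ℕ} (U X : Set (Fin n → ℝ)) : Prop :=
  X ⊆ U ∧ closure X ∩ U ⊆ X ∧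
  ∀ b ∈ X, ∃ V : Set (Fin n → ℝ), IsOpen V ∧ b ∈ V ∧ V ⊆ U ∧
    ∃ (k : ℕ) (g : Fin k → ((Fin n → ℝ) → ℝ)),
      (∀ i, MemDC M V (g i)) ∧ X ∩ V = {x ∈ V | ∀ i, g i x = 0}

/-- `f : X∖Z → ℝ` belongs to `Q_M(X,Z)`: it is a quotient `g/h` of restrictions to `X` of
functions of class `Q_M` on a neighbourhood of `X`, where `h` vanishes nowhere on `X∖Z`. -/
def MemQXZ (M : ℕ → ℝ) {n : ℕ} (X Z : Set (Fin n → ℝ)) (f : (Fin n → ℝ) → ℝ) : Prop :=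
  ∃ (V : Set (Fin n → ℝ)) (g h : (Fin n → ℝ) → ℝ), IsOpen V ∧ X ⊆ V ∧
    MemDC M V g ∧ MemDC M V h ∧ (∀ x ∈ X \ Z, h x ≠ 0) ∧
    ∀ x ∈ X \ Z, f x = g x / h x

/-- `b` is a `Q_M`-smooth point of `X ⊆ ℝ^n`: near `b`, `X` is the graph of a
`Q_M`-map over some subset `I` of the coordinates. -/
def QMSmoothPt (M : ℕ → ℝ) {n : ℕ} (X : Set (Fin n → ℝ)) (b : Fin n → ℝ) : Prop :=
  ∃ W : Set (Fin n → ℝ), IsOpen W ∧ b ∈ W ∧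
    ∃ (I : Finset (Fin n)) (Ω : Set ({ i : Fin n // i ∈ I } → ℝ))
      (ψ : ({ i : Fin n // i ∈ I } → ℝ) → ({ i : Fin n // i ∉ I } → ℝ)),
      IsOpen Ω ∧ (∀ j : { i : Fin n // i ∉ I }, MemDC M Ω (fun u => ψ u j)) ∧
      X ∩ W = {y ∈ W | (fun i : { i : Fin n // i ∈ I } => y i) ∈ Ω ∧
        ∀ j : { i : Fin n // i ∉ I }, y j = ψ (fun i : { i : Fin n // i ∈ I } => y i) j}

/-- The formal Taylor expansion `T_a f` of `f` at `a`, as a multivariate formal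
power series. -/
noncomputable def taylorAt {n : ℕ} (f : (Fin n → ℝ) → ℝ) (a : Fin n → ℝ) :
    MvPowerSeries (Fin n) ℝ :=
  fun α : Fin n →₀ ℕ => mpd (fun i => α i) f a / (mfact fun i => α i : ℕ)

/-- `f` is flat at `x`: all iterated partial derivatives (including order `0`) vanish. -/
def FlatAt {n : ℕ} (f : (Fin n → ℝ) → ℝ) (x : Fin n → ℝ) : Prop :=
  ∀ α : Fin n → ℕ, mpd α f x = 0

end QDC

namespace HLD
open Set Filter Topology QDC
open scoped ContDiff

section Taylor
variable {n : ℕ}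

lemma pd_smooth {U : Set (Fin n → ℝ)} (hU : IsOpen U) {f : (Fin n → ℝ) → ℝ}
    (hf : ContDiffOn ℝ ∞ f U) (i : Fin n) : ContDiffOn ℝ ∞ (pd i f) U := by
  have h := hf.fderiv_of_isOpen hU (m := ∞) (by simp)
  exact h.clm_apply contDiffOn_const

lemma pd_congr {U : Set (Fin n → ℝ)} (hU : IsOpen U) {f g : (Fin n → ℝ) → ℝ}
    (h : EqOn f g U) (i : Fin n) : EqOn (pd i f) (pd i g) U := by
  intro x hx
  have : f =ᶠ[𝓝 x] g := h.eventuallyEq_of_mem (hU.mem_nhds hx)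
  simp only [pd, this.fderiv_eq]

lemma pd_comm {U : Set (Fin n → ℝ)} (hU : IsOpen U) {f : (Fin n → ℝ) → ℝ}
    (hf : ContDiffOn ℝ ∞ f U) (i j : Fin n) : EqOn (pd i (pd j f)) (pd j (pd i f)) U := by
  intro x hx
  have hfa : ContDiffAt ℝ ∞ f x := hf.contDiffAt (hU.mem_nhds hx)
  have hs : IsSymmSndFDerivAt ℝ f x := hfa.isSymmSndFDerivAt (by simp only [minSmoothness_of_isRCLikeNormedField]; exact WithTop.coe_le_coe.2 le_top)
  have hd : DifferentiableAt ℝ (fderiv ℝ f) x :=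
    (hfa.fderiv_right (m := 1) (by norm_cast)).differentiableAt (by simp)
  have key : ∀ v w : Fin n → ℝ, fderiv ℝ (fun y => fderiv ℝ f y v) x w
      = fderiv ℝ (fderiv ℝ f) x w v := by
    intro v w
    rw [fderiv_clm_apply hd (differentiableAt_const _)]
    simp
  unfold pd
  rw [key, key]
  exact hs _ _

/-- iterated partials along a list -/
noncomputable def lpd (α : Fin n → ℕ) (l : List (Fin n)) (f : (Fin n → ℝ) → ℝ) :
    (Fin n → ℝ) → ℝ := l.foldr (fun i g => (pd i)^[α i] g) f

lemma pdit_smooth {U : Set (Fin n → ℝ)} (hU : IsOpen U) {f : (Fin n → ℝ) → ℝ}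
    (hf : ContDiffOn ℝ ∞ f U) (i : Fin n) (k : ℕ) : ContDiffOn ℝ ∞ ((pd i)^[k] f) U := by
  induction k with
  | zero => simpa
  | succ k ih => rw [Function.iterate_succ_apply']; exact pd_smooth hU ih i

lemma pdit_congr {U : Set (Fin n → ℝ)} (hU : IsOpen U) {f g : (Fin n → ℝ) → ℝ}
    (h : EqOn f g U) (i : Fin n) (k : ℕ) : EqOn ((pd i)^[k] f) ((pd i)^[k] g) U := by
  induction k with
  | zero => simpa
  | succ k ih => simp only [Function.iterate_succ_apply']; exact pd_congr hU ih i

lemma pdit_comm {U : Set (Fin n → ℝ)} (hU : IsOpen U) {f : (Fin n → ℝ) → ℝ}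
    (hf : ContDiffOn ℝ ∞ f U) (i j : Fin n) (k : ℕ) :
    EqOn (pd j ((pd i)^[k] f)) ((pd i)^[k] (pd j f)) U := by
  induction k with
  | zero => intro x _; rfl
  | succ k ih =>
    simp only [Function.iterate_succ_apply']
    exact (pd_comm hU (pdit_smooth hU hf i k) j i).trans (pd_congr hU ih i)

lemma lpd_smooth {U : Set (Fin n → ℝ)} (hU : IsOpen U) {f : (Fin n → ℝ) → ℝ}
    (hf : ContDiffOn ℝ ∞ f U) (α : Fin n → ℕ) (l : List (Fin n)) :
    ContDiffOn ℝ ∞ (lpd α l f) U := by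
  induction l with
  | nil => simpa [lpd]
  | cons i l ih => exact pdit_smooth hU ih i _

lemma lpd_congr {U : Set (Fin n → ℝ)} (hU : IsOpen U) {f g : (Fin n → ℝ) → ℝ}
    (h : EqOn f g U) (α : Fin n → ℕ) (l : List (Fin n)) : EqOn (lpd α l f) (lpd α l g) U := by
  induction l with
  | nil => simpa [lpd]
  | cons i l ih => exact pdit_congr hU ih i _

lemma lpd_comm {U : Set (Fin n → ℝ)} (hU : IsOpen U) {f : (Fin n → ℝ) → ℝ}
    (hf : ContDiffOn ℝ ∞ f U) (α : Fin n → ℕ) (j : Fin n) (l : List (Fin n)) :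
    EqOn (pd j (lpd α l f)) (lpd α l (pd j f)) U := by
  induction l with
  | nil => intro x _; rfl
  | cons i l ih =>
    exact (pdit_comm hU (lpd_smooth hU hf α l) i j _).trans (pdit_congr hU ih i _)

lemma lpd_notMem (α : Fin n → ℕ) (j : Fin n) (l : List (Fin n)) (hj : j ∉ l)
    (f : (Fin n → ℝ) → ℝ) : lpd (α + Pi.single j 1) l f = lpd α l f := by
  induction l with
  | nil => rfl
  | cons i l ih =>
    simp only [List.mem_cons, not_or] at hj
    have h1 : (α + Pi.single j 1 : Fin n → ℕ) i = α i := by simp [Ne.symm hj.1]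
    have := ih hj.2
    unfold lpd at *
    simp only [List.foldr_cons, h1, this]

lemma lpd_mem {U : Set (Fin n → ℝ)} (hU : IsOpen U) {f : (Fin n → ℝ) → ℝ}
    (hf : ContDiffOn ℝ ∞ f U) (α : Fin n → ℕ) (j : Fin n) (l : List (Fin n)) (hj : j ∈ l)
    (hl : l.Nodup) : EqOn (lpd (α + Pi.single j 1) l f) (lpd α l (pd j f)) U := by
  induction l with
  | nil => simp at hj
  | cons i l ih =>
    rw [List.nodup_cons] at hl
    by_cases hij : j = i
    · subst hij
      have h1 : (α + Pi.single j 1 : Fin n → ℕ) j = α j + 1 := by simp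
      change EqOn ((pd j)^[(α + Pi.single j 1 : Fin n → ℕ) j] (lpd (α + Pi.single j 1) l f))
        ((pd j)^[α j] (lpd α l (pd j f))) U
      rw [h1, lpd_notMem α j l hl.1, Function.iterate_succ_apply]
      exact pdit_congr hU (lpd_comm hU hf α j l) j _
    · have h1 : (α + Pi.single j 1 : Fin n → ℕ) i = α i := by simp [Ne.symm hij]
      change EqOn ((pd i)^[(α + Pi.single j 1 : Fin n → ℕ) i] (lpd (α + Pi.single j 1) l f))
        ((pd i)^[α i] (lpd α l (pd j f))) U
      rw [h1]
      exact pdit_congr hU (ih (by simpa [hij] using hj) hl.2) i _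

lemma mpd_pd {U : Set (Fin n → ℝ)} (hU : IsOpen U) {f : (Fin n → ℝ) → ℝ}
    (hf : ContDiffOn ℝ ∞ f U) (α : Fin n → ℕ) (j : Fin n) :
    EqOn (mpd (α + Pi.single j 1) f) (mpd α (pd j f)) U :=
  lpd_mem hU hf α j _ (by simp) (Finset.nodup_toList _)

lemma mpd_zero (f : (Fin n → ℝ) → ℝ) : mpd (fun _ => 0) f = f := by
  unfold mpd
  generalize (Finset.univ : Finset (Fin n)).toList = l
  induction l with
  | nil => rfl
  | cons i l ih => simp

lemma coeff_taylorAt (f : (Fin n → ℝ) → ℝ) (a : Fin n → ℝ) (α : Fin n →₀ ℕ) :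
    MvPowerSeries.coeff α (taylorAt f a) = mpd (fun i => α i) f a / (mfact fun i => α i : ℕ) := rfl

lemma taylor_const (f : (Fin n → ℝ) → ℝ) (a : Fin n → ℝ) :
    MvPowerSeries.coeff 0 (taylorAt f a) = f a := by
  rw [coeff_taylorAt]
  have : (fun i => (0 : Fin n →₀ ℕ) i) = fun _ => 0 := rfl
  rw [this, mpd_zero]
  simp [mfact]

lemma mfact_succ (α : Fin n →₀ ℕ) (j : Fin n) :
    mfact (fun i => (α + Finsupp.single j 1 : Fin n →₀ ℕ) i) = (α j + 1) * mfact (fun i => α i) := by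
  unfold mfact
  rw [← Finset.mul_prod_erase _ _ (Finset.mem_univ j), ← Finset.mul_prod_erase _ (fun i => (α i).factorial) (Finset.mem_univ j)]
  rw [← mul_assoc]
  congr 1
  · simp [Nat.factorial_succ]
  · apply Finset.prod_congr rfl
    intro i hi
    have : i ≠ j := Finset.ne_of_mem_erase hi
    simp [Finsupp.single_apply, Ne.symm this]

lemma taylor_pd {U : Set (Fin n → ℝ)} (hU : IsOpen U) {f : (Fin n → ℝ) → ℝ}
    (hf : ContDiffOn ℝ ∞ f U) {a : Fin n → ℝ} (ha : a ∈ U) (j : Fin n) :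
    taylorAt (pd j f) a = MvPowerSeries.pderiv ℝ j (taylorAt f a) := by
  ext α
  rw [MvPowerSeries.coeff_pderiv, coeff_taylorAt, coeff_taylorAt, mfact_succ]
  have h1 : (fun i => (α + Finsupp.single j 1 : Fin n →₀ ℕ) i) = (fun i => α i) + Pi.single j 1 := by
    ext i
    simp [Finsupp.single_apply, Pi.single_apply, eq_comm]
  rw [h1, mpd_pd hU hf _ j ha]
  have h2 : (mfact (fun i => α i) : ℝ) ≠ 0 := by
    unfold mfact
    exact_mod_cast Finset.prod_ne_zero_iff.2 fun i _ => Nat.factorial_ne_zero _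
  have h3 : ((α j : ℝ) + 1) ≠ 0 := by positivity
  push_cast
  field_simp

lemma taylor_congr {U : Set (Fin n → ℝ)} (hU : IsOpen U) {f g : (Fin n → ℝ) → ℝ}
    (h : EqOn f g U) {a : Fin n → ℝ} (ha : a ∈ U) : taylorAt f a = taylorAt g a := by
  ext α
  rw [coeff_taylorAt, coeff_taylorAt]
  have := lpd_congr hU h (fun i => α i) Finset.univ.toList ha
  unfold lpd at this
  unfold mpd
  rw [this]

lemma coeff_succ_ext (A B : MvPowerSeries (Fin n) ℝ) (α : Fin n →₀ ℕ) (j : Fin n)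
    (h : MvPowerSeries.coeff α (MvPowerSeries.pderiv ℝ j A) =
      MvPowerSeries.coeff α (MvPowerSeries.pderiv ℝ j B)) :
    MvPowerSeries.coeff (α + Finsupp.single j 1) A = MvPowerSeries.coeff (α + Finsupp.single j 1) B := by
  rw [MvPowerSeries.coeff_pderiv, MvPowerSeries.coeff_pderiv] at h
  exact mul_right_cancel₀ (by positivity) h

lemma finsupp_ind {P : (Fin n →₀ ℕ) → Prop} (h0 : P 0)
    (h1 : ∀ α j, P α → P (α + Finsupp.single j 1)) (α) : P α := by
  induction hd : α.degree generalizing α with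
  | zero =>
    rw [Finsupp.degree_eq_zero_iff] at hd
    subst hd; exact h0
  | succ d ih =>
    have hne : α ≠ 0 := by rintro rfl; simp at hd
    obtain ⟨j, hj⟩ := Finsupp.ne_iff.1 hne
    have hle : Finsupp.single j 1 ≤ α := by
      rw [Finsupp.single_le_iff]
      exact Nat.one_le_iff_ne_zero.2 hj
    have he : α = (α - Finsupp.single j 1) + Finsupp.single j 1 := (tsub_add_cancel_of_le hle).symm
    rw [he]
    apply h1
    apply ih
    rw [he] at hd
    rw [map_add] at hd
    simpa using hd

lemma smooth_diffAt {U : Set (Fin n → ℝ)} (hU : IsOpen U) {f : (Fin n → ℝ) → ℝ}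
    (hf : ContDiffOn ℝ ∞ f U) {a : Fin n → ℝ} (ha : a ∈ U) : DifferentiableAt ℝ f a :=
  (hf.contDiffAt (hU.mem_nhds ha)).differentiableAt (by simp)

lemma taylor_add {U : Set (Fin n → ℝ)} (hU : IsOpen U) {a : Fin n → ℝ} (ha : a ∈ U)
    {f g : (Fin n → ℝ) → ℝ} (hf : ContDiffOn ℝ ∞ f U) (hg : ContDiffOn ℝ ∞ g U) :
    taylorAt (fun x => f x + g x) a = taylorAt f a + taylorAt g a := by
  ext α
  induction α using finsupp_ind generalizing f g with
  | h0 => rw [map_add]; simp only [taylor_const]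
  | h1 α j ih =>
    apply coeff_succ_ext
    rw [map_add, ← taylor_pd hU (hf.add hg) ha, ← taylor_pd hU hf ha, ← taylor_pd hU hg ha,
      ← ih (pd_smooth hU hf j) (pd_smooth hU hg j)]
    congr 1
    apply taylor_congr hU _ ha
    intro x hx
    simp only [pd]
    rw [fderiv_fun_add (smooth_diffAt hU hf hx) (smooth_diffAt hU hg hx)]
    rfl

lemma taylor_mul {U : Set (Fin n → ℝ)} (hU : IsOpen U) {a : Fin n → ℝ} (ha : a ∈ U)
    {f g : (Fin n → ℝ) → ℝ} (hf : ContDiffOn ℝ ∞ f U) (hg : ContDiffOn ℝ ∞ g U) :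
    taylorAt (fun x => f x * g x) a = taylorAt f a * taylorAt g a := by
  ext α
  induction α using finsupp_ind generalizing f g with
  | h0 =>
    simp only [taylor_const]
    have := map_mul (MvPowerSeries.constantCoeff (σ := Fin n) (R := ℝ)) (taylorAt f a) (taylorAt g a)
    simp only [← MvPowerSeries.coeff_zero_eq_constantCoeff_apply] at this
    rw [this]; simp only [taylor_const]
  | h1 α j ih =>
    apply coeff_succ_ext
    have e : taylorAt (pd j fun x => f x * g x) a =
        taylorAt (fun x => (f x * pd j g x) + (g x * pd j f x)) a := by
      apply taylor_congr hU _ ha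
      intro x hx
      simp only [pd]
      rw [fderiv_fun_mul (smooth_diffAt hU hf hx) (smooth_diffAt hU hg hx)]
      simp
    rw [Derivation.leibniz, ← taylor_pd hU (hf.mul hg) ha, e,
      taylor_add hU ha (hf.mul (pd_smooth hU hg j)) (hg.mul (pd_smooth hU hf j)), map_add, map_add,
      ih hf (pd_smooth hU hg j), ih hg (pd_smooth hU hf j), taylor_pd hU hf ha, taylor_pd hU hg ha]
    rfl

lemma taylor_const_mul {U : Set (Fin n → ℝ)} (hU : IsOpen U) {a : Fin n → ℝ} (ha : a ∈ U)
    {f : (Fin n → ℝ) → ℝ} (hf : ContDiffOn ℝ ∞ f U) :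
    taylorAt (fun x => - f x) a = - taylorAt f a := by
  have h := taylor_add hU ha hf hf.neg
  have h0 : taylorAt (fun x => f x + - f x) a = 0 := by
    have : (fun x => f x + - f x) = fun _ => 0 := by ext; simp
    rw [this]
    have h := taylor_add hU (f := fun _ => 0) (g := fun _ => 0) ha contDiffOn_const contDiffOn_const
    simpa using h
  rw [h0] at h
  exact (neg_eq_of_add_eq_zero_right h.symm).symm

lemma poly_bigO (P : MvPolynomial (Fin n) ℝ) (N : ℕ) (h : ∀ α, α.degree < N → P.coeff α = 0)
    (a : Fin n → ℝ) :
    (fun x => MvPolynomial.eval (fun i => x i - a i) P) =O[𝓝 a] fun x => ‖x - a‖ ^ N := by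
  simp only [MvPolynomial.eval_eq]
  apply Asymptotics.IsBigO.fun_sum
  intro α hα
  have hN : N ≤ α.degree := by
    by_contra hc
    exact MvPolynomial.mem_support_iff.1 hα (h α (not_le.1 hc))
  apply Asymptotics.IsBigO.of_bound (|P.coeff α|)
  have h1 : ∀ᶠ x in 𝓝 a, ‖x - a‖ < 1 := by
    have : Tendsto (fun x => ‖x - a‖) (𝓝 a) (𝓝 0) := by
      have : ContinuousAt (fun x => ‖x - a‖) a := by fun_prop
      simpa [ContinuousAt] using this
    exact this.eventually (gt_mem_nhds one_pos)
  filter_upwards [h1] with x hx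
  rw [norm_mul, Real.norm_eq_abs]
  gcongr
  have hp : ∏ i, (‖x - a‖) ^ α i ≤ ‖x - a‖ ^ N := by
    rw [Finset.prod_pow_eq_pow_sum]
    apply pow_le_pow_of_le_one (norm_nonneg _) hx.le
    rwa [Finsupp.degree_eq_sum] at hN
  rw [norm_prod, Real.norm_of_nonneg (by positivity)]
  refine le_trans ?_ hp
  have hs : ∏ b ∈ α.support, ‖(x b - a b) ^ α b‖ = ∏ b, ‖(x b - a b) ^ α b‖ := by
    apply Finset.prod_subset (Finset.subset_univ _)
    intro b _ hb
    simp [Finsupp.notMem_support_iff.1 hb]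
  rw [hs]
  apply Finset.prod_le_prod
  · intros; positivity
  · intro i _
    rw [norm_pow]
    gcongr
    exact norm_le_pi_norm (x - a) i

lemma hasFDerivAt_evalPoly (P : MvPolynomial (Fin n) ℝ) (a x : Fin n → ℝ) :
    HasFDerivAt (fun x : Fin n → ℝ => MvPolynomial.eval (fun i => x i - a i) P)
      (∑ i, MvPolynomial.eval (fun i => x i - a i) (MvPolynomial.pderiv i P) •
        ContinuousLinearMap.proj (R := ℝ) (φ := fun _ : Fin n => ℝ) i) x := by
  induction P using MvPolynomial.induction_on with
  | C c => simpa using hasFDerivAt_const _ _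
  | add p q hp hq =>
    simp only [map_add]
    refine (hp.add hq).congr_fderiv ?_
    simp only [add_smul, Finset.sum_add_distrib]
  | mul_X p j hp =>
    simp only [map_mul, MvPolynomial.eval_X]
    have h2 : HasFDerivAt (fun x : Fin n → ℝ => x j - a j)
      (ContinuousLinearMap.proj (R := ℝ) (φ := fun _ : Fin n => ℝ) j) x :=
      ((ContinuousLinearMap.proj (R := ℝ) (φ := fun _ : Fin n => ℝ) j).hasFDerivAt).sub_const _
    refine (hp.mul h2).congr_fderiv ?_
    ext v
    simp only [Derivation.leibniz, MvPolynomial.pderiv_X, smul_eq_mul, map_add, map_mul, MvPolynomial.eval_X,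
      ContinuousLinearMap.sum_apply, ContinuousLinearMap.add_apply, ContinuousLinearMap.smul_apply,
      ContinuousLinearMap.proj_apply, add_mul, Finset.sum_add_distrib, Finset.mul_sum]
    congr 1
    · rw [Finset.sum_eq_single j]
      · simp
      · intro b _ hb
        simp [Pi.single_apply, hb]
      · simp
    · apply Finset.sum_congr rfl
      intros; ring

lemma clm_norm_le (L : (Fin n → ℝ) →L[ℝ] ℝ) : ‖L‖ ≤ ∑ i, ‖L (Pi.single i 1)‖ := by
  apply ContinuousLinearMap.opNorm_le_bound _ (by positivity)
  intro v
  have : L v = ∑ i, v i * L (Pi.single i 1) := by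
    conv_lhs => rw [← Finset.univ_sum_single v]
    rw [map_sum]
    apply Finset.sum_congr rfl
    intro i _
    have : (Pi.single i (v i) : Fin n → ℝ) = v i • Pi.single i 1 := by
      rw [← Pi.single_smul]; simp
    rw [this, map_smul, smul_eq_mul]
  rw [this, Finset.sum_mul]
  refine (norm_sum_le _ _).trans (Finset.sum_le_sum fun i _ => ?_)
  rw [norm_mul, mul_comm]
  gcongr
  exact norm_le_pi_norm v i

lemma taylor_bigO {U : Set (Fin n → ℝ)} (hU : IsOpen U) {a : Fin n → ℝ} (ha : a ∈ U)
    (N : ℕ) {f : (Fin n → ℝ) → ℝ} (hf : ContDiffOn ℝ ∞ f U) :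
    (fun x => f x - MvPolynomial.eval (fun i => x i - a i) (MvPowerSeries.truncTotal N (taylorAt f a)))
      =O[𝓝 a] fun x => ‖x - a‖ ^ N := by
  induction N generalizing f with
  | zero =>
    simp only [pow_zero]
    have h0 : ContinuousAt (fun x => f x - MvPolynomial.eval (fun i => x i - a i) (MvPowerSeries.truncTotal 0 (taylorAt f a))) a :=
      ContinuousAt.sub (smooth_diffAt hU hf ha).continuousAt (hasFDerivAt_evalPoly _ a a).continuousAt
    exact h0.isBigO_one ℝ
  | succ N ih =>
    set P := MvPowerSeries.truncTotal (N+1) (taylorAt f a) with hP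
    set R := fun x => f x - MvPolynomial.eval (fun i => x i - a i) P with hR
    have hPd : ∀ j, MvPolynomial.pderiv j P = MvPowerSeries.truncTotal N (taylorAt (pd j f) a) := by
      intro j
      ext α
      rw [MvPolynomial.coeff_pderiv, hP, MvPowerSeries.coeff_truncTotal_eq_ite, MvPowerSeries.coeff_truncTotal_eq_ite,
        taylor_pd hU hf ha, MvPowerSeries.coeff_pderiv, map_add]
      simp
    have hRa : R a = 0 := by
      have : (fun i => a i - a i) = (0 : Fin n → ℝ) := by ext; simp
      simp only [hR, this]
      rw [MvPolynomial.eval_zero, MvPolynomial.constantCoeff_eq, hP, MvPowerSeries.coeff_truncTotal_eq_ite]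
      simp [taylor_const]
    have hD : ∀ x ∈ U, HasFDerivAt R (fderiv ℝ f x - ∑ i, MvPolynomial.eval (fun i => x i - a i) (MvPolynomial.pderiv i P) •
        ContinuousLinearMap.proj (R := ℝ) (φ := fun _ : Fin n => ℝ) i) x := fun x hx =>
      (smooth_diffAt hU hf hx).hasFDerivAt.sub (hasFDerivAt_evalPoly P a x)
    have hO : ∀ j, ∃ C : ℝ, 0 < C ∧ ∀ᶠ x in 𝓝 a, ‖pd j f x - MvPolynomial.eval (fun i => x i - a i) (MvPolynomial.pderiv j P)‖ ≤ C * ‖x - a‖ ^ N := by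
      intro j
      have := (ih (pd_smooth hU hf j)).exists_pos
      obtain ⟨C, hC, h⟩ := this
      refine ⟨C, hC, ?_⟩
      filter_upwards [h.bound] with x hx
      rw [hPd]
      simpa using hx
    choose C hC hCb using hO
    obtain ⟨r, hr, hball⟩ := Metric.eventually_nhds_iff_ball.1 ((hU.eventually_mem ha).and (eventually_all.2 hCb))
    apply Asymptotics.IsBigO.of_bound (∑ j, C j)
    filter_upwards [Metric.ball_mem_nhds a hr] with x hx
    rw [Metric.mem_ball, dist_eq_norm] at hx
    have hsub : Metric.closedBall a ‖x - a‖ ⊆ Metric.ball a r := Metric.closedBall_subset_ball hx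
    have := (convex_closedBall a ‖x - a‖).norm_image_sub_le_of_norm_hasFDerivWithin_le (f := R) (C := (∑ j, C j) * ‖x - a‖ ^ N)
      (x := a) (y := x)
      (fun y hy => (hD y (hball y (hsub hy)).1).hasFDerivWithinAt) ?_ (by simp) (by simp [dist_eq_norm])
    · rw [hRa, sub_zero] at this
      rw [norm_pow, norm_norm, pow_succ, ← mul_assoc]
      exact this
    · intro y hy
      refine (clm_norm_le _).trans ?_
      rw [Finset.sum_mul]
      apply Finset.sum_le_sum
      intro j _
      have h1 := (hball y (hsub hy)).2 j
      have h2 : ‖y - a‖ ≤ ‖x - a‖ := by simpa [dist_eq_norm] using hy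
      refine le_trans (le_trans (le_of_eq ?_) h1) ?_
      · congr 1
        simp [pd, Pi.single_apply]
      · have := (hC j).le
        gcongr

/-- formal divisibility, weak form, with value `c` at `a` -/
def FDV {E : Type*} [NormedAddCommGroup E] (f φ : E → ℝ) (a : E) (c : ℝ) : Prop :=
  ∀ N : ℕ, ∃ g : E → ℝ, ContinuousAt g a ∧ g a = c ∧
    (fun x => f x - g x * φ x) =O[𝓝 a] fun x => ‖x - a‖ ^ N

lemma FDV_of_formal {U : Set (Fin n → ℝ)} (hU : IsOpen U) {a : Fin n → ℝ} (ha : a ∈ U)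
    {f φ : (Fin n → ℝ) → ℝ} (hf : ContDiffOn ℝ ∞ f U) (hφ : ContDiffOn ℝ ∞ φ U)
    (G : MvPowerSeries (Fin n) ℝ) (h : taylorAt f a = G * taylorAt φ a) :
    FDV f φ a (MvPowerSeries.coeff 0 G) := by
  intro N
  have hc : ∀ M, ContinuousAt (fun x => MvPolynomial.eval (fun i => x i - a i) (MvPowerSeries.truncTotal M G)) a :=
    fun M => (hasFDerivAt_evalPoly _ a a).continuousAt
  refine ⟨fun x => MvPolynomial.eval (fun i => x i - a i) (MvPowerSeries.truncTotal (N+1) G), hc _, ?_, ?_⟩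
  · have : (fun i => a i - a i) = (0 : Fin n → ℝ) := by ext; simp
    simp only [this]
    rw [MvPolynomial.eval_zero, MvPolynomial.constantCoeff_eq, MvPowerSeries.coeff_truncTotal_eq_ite]
    simp
  · have h1 := taylor_bigO hU ha (N+1) hf
    have h2 := taylor_bigO hU ha (N+1) hφ
    have h3 := ((hc (N+1)).isBigO_one ℝ).mul h2
    have h4 := poly_bigO (MvPowerSeries.truncTotal (N+1) (taylorAt f a) - MvPowerSeries.truncTotal (N+1) G * MvPowerSeries.truncTotal (N+1) (taylorAt φ a)) (N+1) (by
      intro α hα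
      rw [MvPolynomial.coeff_sub, MvPowerSeries.coeff_truncTotal_mul_truncTotal_eq_coeff_mul _ _ hα, ← h, MvPowerSeries.coeff_truncTotal_eq_ite, if_pos hα, sub_self]) a
    simp only [one_mul] at h3
    have h5 := (h1.sub h3).add h4
    refine (h5.congr_left ?_).trans ?_
    · intro x
      simp only [map_sub, map_mul]
      ring
    · simp only [pow_succ]
      have : ContinuousAt (fun x : Fin n → ℝ => ‖x - a‖) a := by fun_prop
      simpa using (Asymptotics.isBigO_refl (fun x : Fin n → ℝ => ‖x - a‖^N) (𝓝 a)).mul (this.isBigO_one ℝ)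

end Taylor
end HLD

namespace HLD
open Set Filter Topology QDC MeasureTheory
open scoped ContDiff Convolution

section MonDiv
variable {n : ℕ}

lemma update_eq_add (y : Fin n → ℝ) (i : Fin n) (s : ℝ) :
    Function.update y i s = y + (s - y i) • (Pi.single i 1 : Fin n → ℝ) := by
  ext j
  by_cases h : j = i
  · subst h; simp
  · simp [h]

lemma update_mem_ball {r : ℝ} {y : Fin n → ℝ} (hy : y ∈ Metric.ball (0 : Fin n → ℝ) r) (i : Fin n)
    {s : ℝ} (hs : |s| < r) : Function.update y i s ∈ Metric.ball (0 : Fin n → ℝ) r := by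
  have hr : 0 < r := (abs_nonneg s).trans_lt hs
  rw [mem_ball_zero_iff, pi_norm_lt_iff hr] at *
  intro j
  by_cases h : j = i
  · subst h; simpa using hs
  · simpa [h] using hy j

lemma abs_coord_lt {r : ℝ} {y : Fin n → ℝ} (hy : y ∈ Metric.ball (0 : Fin n → ℝ) r) (i : Fin n) :
    |y i| < r := by
  rw [mem_ball_zero_iff] at hy
  exact (norm_le_pi_norm y i).trans_lt hy

lemma hadamard {r : ℝ} {F : (Fin n → ℝ) → ℝ} (hF : ContDiffOn ℝ ∞ F (Metric.ball 0 r)) (i : Fin n)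
    (h0 : ∀ y ∈ Metric.ball (0 : Fin n → ℝ) r, y i = 0 → F y = 0) :
    ∃ H : (Fin n → ℝ) → ℝ, ContDiffOn ℝ ∞ H (Metric.ball 0 r) ∧
      ∀ y ∈ Metric.ball (0 : Fin n → ℝ) r, F y = y i * H y := by
  set θ : ℝ → ℝ := Real.smoothTransition with hθ
  have hθs : ContDiff ℝ ∞ θ := Real.smoothTransition.contDiff
  have hθd : ContDiff ℝ ∞ (deriv θ) := by
    have := hθs
    rw [show (∞ : WithTop ℕ∞) = ∞ + 1 by rfl, contDiff_succ_iff_deriv] at this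
    exact this.2.2
  have hB : IsOpen (Metric.ball (0 : Fin n → ℝ) r) := Metric.isOpen_ball
  have hmem : ∀ y ∈ Metric.ball (0 : Fin n → ℝ) r, ∀ t, Function.update y i (θ t * y i) ∈ Metric.ball (0 : Fin n → ℝ) r := by
    intro y hy t
    apply update_mem_ball hy
    rw [abs_mul, abs_of_nonneg (Real.smoothTransition.nonneg t)]
    calc θ t * |y i| ≤ 1 * |y i| := by gcongr; exact Real.smoothTransition.le_one t
      _ < r := by rw [one_mul]; exact abs_coord_lt hy i
  have hsm : ContDiffOn ℝ ∞ (fun q : (Fin n → ℝ) × ℝ => pd i F (Function.update q.1 i (θ (-q.2) * q.1 i))) (Metric.ball 0 r ×ˢ univ) := by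
    refine ContDiffOn.comp (t := Metric.ball 0 r) (pd_smooth hB hF i) ?_ ?_
    · apply ContDiff.contDiffOn
      simp only [update_eq_add]
      have : ContDiff ℝ ∞ (fun q : (Fin n → ℝ) × ℝ => θ (-q.2)) := hθs.comp contDiff_snd.neg
      have h2 : ContDiff ℝ ∞ (fun q : (Fin n → ℝ) × ℝ => q.1 i) := by fun_prop
      exact contDiff_fst.add (((this.mul h2).sub h2).smul contDiff_const)
    · intro q hq
      exact hmem q.1 hq.1 _
  set g : (Fin n → ℝ) → ℝ → ℝ := fun y t => deriv θ (-t) * pd i F (Function.update y i (θ (-t) * y i)) with hg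
  have hgs : ContDiffOn ℝ ∞ (Function.HasUncurry.uncurry g) (Metric.ball 0 r ×ˢ univ) := by
    have h1 : ContDiff ℝ ∞ (fun q : (Fin n → ℝ) × ℝ => deriv θ (-q.2)) := hθd.comp contDiff_snd.neg
    exact h1.contDiffOn.mul hsm
  have hd0 : ∀ t, t ∉ Icc (0:ℝ) 1 → deriv θ t = 0 := by
    intro t ht
    rcases lt_or_ge t 0 with h | h
    · have : θ =ᶠ[𝓝 t] fun _ => 0 := by
        filter_upwards [gt_mem_nhds h] with s hs
        exact Real.smoothTransition.zero_of_nonpos hs.le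
      rw [this.deriv_eq]; simp
    · have h1 : 1 < t := by by_contra hc; exact ht ⟨h, not_lt.1 hc⟩
      have : θ =ᶠ[𝓝 t] fun _ => 1 := by
        filter_upwards [lt_mem_nhds h1] with s hs
        exact Real.smoothTransition.one_of_one_le hs.le
      rw [this.deriv_eq]; simp
  have hconv := contDiffOn_convolution_right_with_param (𝕜 := ℝ) (μ := (volume : Measure ℝ)) (f := fun _ : ℝ => (1:ℝ)) (n := ⊤)
    (ContinuousLinearMap.mul ℝ ℝ) (g := g) (k := Icc (-1) 0) hB isCompact_Icc (by
      intro p x _ hx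
      simp only [hg]
      rw [hd0 (-x) (by intro h; apply hx; constructor <;> linarith [h.1, h.2]), zero_mul])
    (locallyIntegrable_const _) hgs
  refine ⟨fun y => ((fun _ : ℝ => (1:ℝ)) ⋆[ContinuousLinearMap.mul ℝ ℝ, volume] g y) 0, ?_, ?_⟩
  · have : ContDiff ℝ ∞ (fun y : Fin n → ℝ => (y, (0:ℝ))) := by fun_prop
    exact hconv.comp this.contDiffOn (fun y hy => ⟨hy, mem_univ _⟩)
  · intro y hy
    have e1 : ((fun _ : ℝ => (1:ℝ)) ⋆[ContinuousLinearMap.mul ℝ ℝ, volume] g y) 0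
        = ∫ t in (0:ℝ)..1, deriv θ t * pd i F (Function.update y i (θ t * y i)) := by
      rw [convolution_def, intervalIntegral.integral_of_le zero_le_one, ← integral_Icc_eq_integral_Ioc,
        setIntegral_eq_integral_of_forall_compl_eq_zero]
      · simp [hg]
      · intro t ht
        rw [hd0 t ht, zero_mul]
    show F y = y i * ((fun _ : ℝ => (1:ℝ)) ⋆[ContinuousLinearMap.mul ℝ ℝ, volume] g y) 0
    rw [e1, ← intervalIntegral.integral_const_mul]
    have hcont : ContDiff ℝ ∞ (fun t => pd i F (Function.update y i (θ t * y i))) := by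
      have h1 : ContDiff ℝ ∞ (fun t : ℝ => (y, -t)) := by fun_prop
      rw [← contDiffOn_univ]
      have := hsm.comp h1.contDiffOn (s := univ) (fun t _ => ⟨hy, mem_univ _⟩)
      simpa [Function.comp_def] using this
    have := intervalIntegral.integral_eq_sub_of_hasDerivAt (a := 0) (b := 1) (f := fun t => F (Function.update y i (θ t * y i)))
      (f' := fun t => y i * (deriv θ t * pd i F (Function.update y i (θ t * y i)))) ?_ ?_
    · rw [this]
      simp only [hθ, Real.smoothTransition.one, Real.smoothTransition.zero, one_mul, zero_mul, Function.update_eq_self]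
      rw [h0 (Function.update y i 0), sub_zero]
      · have := hmem y hy 0
        simpa [hθ, Real.smoothTransition.zero] using this
      · simp
    · intro t _
      have h1 : HasFDerivAt F (fderiv ℝ F (Function.update y i (θ t * y i))) (Function.update y i (θ t * y i)) :=
        (smooth_diffAt hB hF (hmem y hy t)).hasFDerivAt
      have h2 : HasDerivAt (fun t => Function.update y i (θ t * y i)) ((deriv θ t * y i) • (Pi.single i 1 : Fin n → ℝ)) t := by
        simp only [update_eq_add]
        have : HasDerivAt θ (deriv θ t) t := (hθs.differentiable (by simp) t).hasDerivAt
        have h3 := ((this.mul_const (y i)).sub_const (y i)).smul_const (Pi.single i 1 : Fin n → ℝ)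
        simpa using h3.const_add y
      have := h1.comp_hasDerivAt t h2
      refine HasDerivAt.congr_deriv this ?_
      simp only [map_smul, smul_eq_mul, pd]
      ring
    · exact ((continuous_const.mul (hθd.continuous.mul hcont.continuous))).intervalIntegrable _ _

lemma mono_div (N : ℕ) {r : ℝ} (β : Fin n → ℕ) (hβ : ∑ i, β i = N) {F : (Fin n → ℝ) → ℝ}
    (hF : ContDiffOn ℝ ∞ F (Metric.ball 0 r))
    (h : ∀ i, ∀ p ∈ Metric.ball (0 : Fin n → ℝ) r, p i = 0 → (∀ j, j ≠ i → p j ≠ 0) →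
      (fun s : ℝ => F (Function.update p i s)) =O[𝓝[≠] 0] fun s => s ^ β i) :
    ∃ H : (Fin n → ℝ) → ℝ, ContDiffOn ℝ ∞ H (Metric.ball 0 r) ∧
      ∀ y ∈ Metric.ball (0 : Fin n → ℝ) r, F y = H y * ∏ i, y i ^ β i := by
  induction N generalizing β F with
  | zero =>
    refine ⟨F, hF, fun y hy => ?_⟩
    have : ∀ i, β i = 0 := by simpa using hβ
    simp [this]
  | succ N ih =>
    obtain ⟨i, hi⟩ : ∃ i, β i ≠ 0 := by
      by_contra! hc
      simp [hc] at hβ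
    have hB : IsOpen (Metric.ball (0 : Fin n → ℝ) r) := Metric.isOpen_ball
    have hz : ∀ p ∈ Metric.ball (0 : Fin n → ℝ) r, p i = 0 → (∀ j, j ≠ i → p j ≠ 0) → F p = 0 := by
      intro p hp hpi hpj
      have h1 := h i p hp hpi hpj
      have h2 : Tendsto (fun s : ℝ => F (Function.update p i s)) (𝓝[≠] 0) (𝓝 0) := by
        apply h1.trans_tendsto
        have : Tendsto (fun s : ℝ => s ^ β i) (𝓝 0) (𝓝 0) := by
          have : Continuous (fun s : ℝ => s ^ β i) := by fun_prop
          simpa [hi] using this.tendsto 0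
        exact this.mono_left nhdsWithin_le_nhds
      have h3 : Tendsto (fun s : ℝ => F (Function.update p i s)) (𝓝[≠] 0) (𝓝 (F p)) := by
        have hc : ContinuousAt F p := (smooth_diffAt hB hF hp).continuousAt
        have hu : Tendsto (fun s : ℝ => Function.update p i s) (𝓝[≠] 0) (𝓝 p) := by
          have : Continuous (fun s : ℝ => Function.update p i s) := by fun_prop
          have h := (this.tendsto 0).mono_left (nhdsWithin_le_nhds (s := {0}ᶜ))
          rwa [← hpi, Function.update_eq_self, hpi] at h
        exact hc.tendsto.comp hu
      exact tendsto_nhds_unique h3 h2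
    have hz2 : ∀ p ∈ Metric.ball (0 : Fin n → ℝ) r, p i = 0 → F p = 0 := by
      intro p hp hpi
      set q : ℝ → (Fin n → ℝ) := fun s j => if j = i then 0 else p j + s with hq
      have hq0 : q 0 = p := by
        ext j; by_cases hj : j = i
        · subst hj; simp [hq, hpi]
        · simp [hq, hj]
      have hqc : Continuous q := by
        apply continuous_pi
        intro j
        by_cases hj : j = i
        · simp [hq, hj]
          exact continuous_const
        · simp [hq, hj]
          fun_prop
      have hqt : Tendsto q (𝓝[≠] 0) (𝓝 p) := by
        have := (hqc.tendsto 0).mono_left (nhdsWithin_le_nhds (s := {0}ᶜ))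
        rwa [hq0] at this
      have hne : ∀ j, ∀ᶠ s in 𝓝[≠] (0:ℝ), j ≠ i → q s j ≠ 0 := by
        intro j
        by_cases hp0 : p j = 0
        · filter_upwards [self_mem_nhdsWithin] with s hs hj
          simpa [hq, hj, hp0] using hs
        · have : ∀ᶠ s in 𝓝 (0:ℝ), p j + s ≠ 0 := by
            have : ContinuousAt (fun s : ℝ => p j + s) 0 := by fun_prop
            exact this.eventually_ne (by simpa using hp0)
          filter_upwards [this.filter_mono nhdsWithin_le_nhds] with s hs hj
          simpa [hq, hj] using hs
      have hev : ∀ᶠ s in 𝓝[≠] (0:ℝ), F (q s) = 0 := by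
        filter_upwards [eventually_all.2 hne, hqt.eventually (hB.eventually_mem hp)] with s h1 h2
        exact hz _ h2 (by simp [hq]) h1
      have hc : ContinuousAt F p := (smooth_diffAt hB hF hp).continuousAt
      refine tendsto_nhds_unique (hc.tendsto.comp hqt) ?_
      exact (tendsto_congr' hev).2 tendsto_const_nhds
    obtain ⟨F₁, hF₁, hFF⟩ := hadamard hF i hz2
    set β' := Function.update β i (β i - 1) with hβ'
    have hsum : ∑ j, β' j = N := by
      have h1 : ∑ j, β' j + 1 = ∑ j, β j := by
        rw [← Finset.add_sum_erase _ _ (Finset.mem_univ i), ← Finset.add_sum_erase _ β (Finset.mem_univ i)]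
        have : ∑ x ∈ Finset.univ.erase i, β' x = ∑ x ∈ Finset.univ.erase i, β x := by
          apply Finset.sum_congr rfl
          intro j hj
          simp [hβ', Finset.ne_of_mem_erase hj]
        rw [this]
        simp only [hβ', Function.update_self]
        omega
      omega
    have hprod : ∀ y : Fin n → ℝ, ∏ j, y j ^ β j = y i * ∏ j, y j ^ β' j := by
      intro y
      rw [← Finset.mul_prod_erase _ _ (Finset.mem_univ i), ← Finset.mul_prod_erase _ (fun j => y j ^ β' j) (Finset.mem_univ i)]
      have : ∏ x ∈ Finset.univ.erase i, y x ^ β' x = ∏ x ∈ Finset.univ.erase i, y x ^ β x := by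
        apply Finset.prod_congr rfl
        intro j hj
        simp [hβ', Finset.ne_of_mem_erase hj]
      rw [this, ← mul_assoc]
      congr 1
      simp only [hβ', Function.update_self]
      rw [← pow_succ', Nat.sub_add_cancel (Nat.one_le_iff_ne_zero.2 hi)]
    obtain ⟨H, hH, hHF⟩ := ih β' hsum hF₁ (by
      intro j p hp hpj hpk
      have h1 := h j p hp hpj hpk
      have hr : 0 < r := Metric.pos_of_mem_ball hp
      have hsm : ∀ᶠ s in 𝓝[≠] (0:ℝ), |s| < r := by
        have : ∀ᶠ s in 𝓝 (0:ℝ), |s| < r := by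
          have : ContinuousAt (fun s : ℝ => |s|) 0 := by fun_prop
          exact this.eventually (gt_mem_nhds (by simpa using hr))
        exact this.filter_mono nhdsWithin_le_nhds
      obtain ⟨C, hC⟩ := h1.bound
      by_cases hji : j = i
      · subst hji
        apply Asymptotics.IsBigO.of_bound C
        filter_upwards [hC, hsm, self_mem_nhdsWithin] with s h1 h2 h3
        rw [hFF _ (update_mem_ball hp j h2)] at h1
        have hs0 : 0 < |s| := abs_pos.2 h3
        have e : β j = β' j + 1 := by simp [hβ']; omega
        rw [e, pow_succ'] at h1
        simp only [Function.update_self, norm_mul, Real.norm_eq_abs] at h1 ⊢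
        have : |s| * |F₁ (Function.update p j s)| ≤ |s| * (C * |s ^ β' j|) := by linarith
        exact le_of_mul_le_mul_left this hs0
      · have hpi := hpk i (Ne.symm hji)
        apply Asymptotics.IsBigO.of_bound (C / |p i|)
        filter_upwards [hC, hsm] with s h1 h2
        rw [hFF _ (update_mem_ball hp j h2)] at h1
        have hb : β' j = β j := by simp [hβ', hji]
        rw [hb]
        simp only [norm_mul, Real.norm_eq_abs, Function.update_of_ne (Ne.symm hji)] at h1 ⊢
        have : 0 < |p i| := abs_pos.2 hpi
        rw [div_mul_eq_mul_div, le_div_iff₀ this]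
        linarith)
    refine ⟨H, hH, fun y hy => ?_⟩
    rw [hFF y hy, hHF y hy, hprod y]
    ring

lemma M2 {r : ℝ} (hr : 0 < r) (β : Fin n → ℕ) {F Φ u : (Fin n → ℝ) → ℝ} {c : ℝ}
    (hF : ContDiffOn ℝ ∞ F (Metric.ball 0 r)) (hu : ContinuousOn u (Metric.ball 0 r))
    (hΦ : ∀ y ∈ Metric.ball (0 : Fin n → ℝ) r, Φ y = u y * ∏ i, y i ^ β i)
    (hdiv : ∀ p ∈ Metric.ball (0 : Fin n → ℝ) r, ∃ c, FDV F Φ p c) (h0 : FDV F Φ 0 c) :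
    ∃ H : (Fin n → ℝ) → ℝ, ContinuousAt H 0 ∧ H 0 = u 0 * c ∧
      ∀ y ∈ Metric.ball (0 : Fin n → ℝ) r, F y = H y * ∏ i, y i ^ β i := by
  have hB : IsOpen (Metric.ball (0 : Fin n → ℝ) r) := Metric.isOpen_ball
  have h0m : (0 : Fin n → ℝ) ∈ Metric.ball (0 : Fin n → ℝ) r := Metric.mem_ball_self hr
  obtain ⟨H, hH, hHF⟩ := mono_div _ β rfl hF (by
    intro i p hp hpi hpj
    obtain ⟨c, hc⟩ := hdiv p hp
    obtain ⟨g, hg, -, hO⟩ := hc (β i)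
    have hup : Tendsto (fun s : ℝ => Function.update p i s) (𝓝[≠] 0) (𝓝 p) := by
      have : Continuous (fun s : ℝ => Function.update p i s) := by fun_prop
      have h := (this.tendsto 0).mono_left (nhdsWithin_le_nhds (s := {0}ᶜ))
      rwa [← hpi, Function.update_eq_self, hpi] at h
    have h1 := hO.comp_tendsto hup
    have hv : ContinuousAt (fun y : Fin n → ℝ => g y * u y * ∏ j ∈ Finset.univ.erase i, y j ^ β j) p := by
      refine ContinuousAt.mul (hg.mul (hu.continuousAt (hB.mem_nhds hp))) ?_
      exact (continuous_finsetProd _ (fun j _ => by fun_prop)).continuousAt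
    have h2 := ((hv.isBigO_one ℝ).comp_tendsto hup).mul (Asymptotics.isBigO_refl (fun s : ℝ => s ^ β i) (𝓝[≠] 0))
    have h3 : (fun s : ℝ => g (Function.update p i s) * Φ (Function.update p i s)) =O[𝓝[≠] 0] fun s => s ^ β i := by
      refine (h2.congr' ?_ ?_)
      · filter_upwards [hup.eventually (hB.eventually_mem hp)] with s hs
        simp only [Function.comp]
        rw [hΦ _ hs, ← Finset.mul_prod_erase _ _ (Finset.mem_univ i)]
        simp only [Function.update_self]
        ring
      · filter_upwards with s
        simp [Function.comp]
    have h4 : (fun s : ℝ => F (Function.update p i s) - g (Function.update p i s) * Φ (Function.update p i s)) =O[𝓝[≠] 0] fun s => s ^ β i := by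
      refine h1.trans ?_
      apply Asymptotics.IsBigO.of_bound 1
      filter_upwards with s
      simp only [Function.comp, update_eq_add, hpi, sub_zero, add_sub_cancel_left, norm_smul, norm_pow, norm_norm, one_mul]
      gcongr
      have : ‖(Pi.single i 1 : Fin n → ℝ)‖ ≤ 1 := by
        rw [pi_norm_le_iff_of_nonneg zero_le_one]
        intro j
        by_cases hj : j = i
        · subst hj; simp
        · simp [hj]
      rw [Real.norm_of_nonneg (by positivity)]
      calc ‖s‖ * ‖(Pi.single i 1 : Fin n → ℝ)‖ ≤ ‖s‖ * 1 := by gcongr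
        _ = ‖s‖ := mul_one _
    exact (h4.add h3).congr_left (fun s => by ring))
  have hHc : ContinuousAt H 0 := (smooth_diffAt hB hH h0m).continuousAt
  refine ⟨H, hHc, ?_, hHF⟩
  obtain ⟨g, hg, hgc, hO⟩ := h0 (∑ i, β i + 1)
  set δ : ℝ → (Fin n → ℝ) := fun s _ => s with hδ
  have hδt : Tendsto δ (𝓝[≠] 0) (𝓝 0) := by
    have : Continuous δ := by fun_prop
    exact (this.tendsto 0).mono_left nhdsWithin_le_nhds
  obtain ⟨C, hC⟩ := (hO.comp_tendsto hδt).bound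
  have huc : ContinuousAt u 0 := hu.continuousAt (hB.mem_nhds h0m)
  have hlim : Tendsto (fun s => H (δ s) - g (δ s) * u (δ s)) (𝓝[≠] 0) (𝓝 0) := by
    apply squeeze_zero_norm' (a := fun s => |C| * |s|)
    · filter_upwards [hC, hδt.eventually (hB.eventually_mem h0m), self_mem_nhdsWithin] with s h1 h2 h3
      simp only [Function.comp, sub_zero, norm_pow, norm_norm] at h1
      rw [hΦ _ h2, hHF _ h2] at h1
      have hpr : ∏ i, δ s i ^ β i = s ^ (∑ i, β i) := by
        simp only [hδ]; rw [Finset.prod_pow_eq_pow_sum]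
      rw [hpr] at h1
      have hnorm : ‖δ s‖ ≤ |s| := by
        rw [pi_norm_le_iff_of_nonneg (abs_nonneg s)]
        intro i; exact le_rfl
      have h4 : ‖H (δ s) * s ^ (∑ i, β i) - g (δ s) * (u (δ s) * s ^ (∑ i, β i))‖ ≤ |C| * |s| ^ (∑ i, β i + 1) := by
        refine h1.trans ?_
        calc C * ‖δ s‖ ^ (∑ i, β i + 1) ≤ |C| * ‖δ s‖ ^ (∑ i, β i + 1) := by
              gcongr; exact le_abs_self C
          _ ≤ _ := by gcongr
      have e : H (δ s) * s ^ (∑ i, β i) - g (δ s) * (u (δ s) * s ^ (∑ i, β i)) = s ^ (∑ i, β i) * (H (δ s) - g (δ s) * u (δ s)) := by ring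
      rw [e, norm_mul, norm_pow, Real.norm_eq_abs s, pow_succ] at h4
      have hs0 : 0 < |s| ^ (∑ i, β i) := by
        have : 0 < |s| := abs_pos.2 h3
        positivity
      have h5 : |s| ^ (∑ i, β i) * ‖H (δ s) - g (δ s) * u (δ s)‖ ≤ |s| ^ (∑ i, β i) * (|C| * |s|) := by linarith
      exact le_of_mul_le_mul_left h5 hs0
    · have : Continuous (fun s : ℝ => |C| * |s|) := by fun_prop
      have h := (this.tendsto 0).mono_left (nhdsWithin_le_nhds (s := {0}ᶜ))
      simpa using h
  have hlim2 : Tendsto (fun s => H (δ s) - g (δ s) * u (δ s)) (𝓝[≠] 0) (𝓝 (H 0 - g 0 * u 0)) :=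
    ((hHc.sub (hg.mul huc)).tendsto).comp hδt
  have := tendsto_nhds_unique hlim2 hlim
  rw [hgc] at this
  linarith

end MonDiv
end HLD

namespace HLD
open Set Filter Topology QDC
open scoped ContDiff

section Division
variable {E : Type*} [NormedAddCommGroup E] [NormedSpace ℝ E]

/-- telescoping operator -/
noncomputable def TT (e : E) (P : E →L[ℝ] E) : ∀ n : ℕ,
    ContinuousMultilinearMap ℝ (fun _ : Fin (n+1) => E) ℝ →L[ℝ] ContinuousMultilinearMap ℝ (fun _ : Fin n => E) ℝ
  | 0 => (ContinuousLinearMap.apply ℝ _ e) ∘L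
      ((continuousMultilinearCurryLeftEquiv ℝ (fun _ : Fin 1 => E) ℝ).toContinuousLinearEquiv :
        _ →L[ℝ] _)
  | (n+1) => (ContinuousLinearMap.apply ℝ _ e) ∘L
      ((continuousMultilinearCurryLeftEquiv ℝ (fun _ : Fin (n+2) => E) ℝ).toContinuousLinearEquiv :
        _ →L[ℝ] _) +
      ((continuousMultilinearCurryLeftEquiv ℝ (fun _ : Fin (n+1) => E) ℝ).symm.toContinuousLinearEquiv :
        _ →L[ℝ] _) ∘L (ContinuousLinearMap.compL ℝ E _ _ (TT e P n)) ∘L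
      ((ContinuousLinearMap.compL ℝ E E _).flip P) ∘L
      ((continuousMultilinearCurryLeftEquiv ℝ (fun _ : Fin (n+2) => E) ℝ).toContinuousLinearEquiv :
        _ →L[ℝ] _)

lemma TT_zero (e : E) (P : E →L[ℝ] E) (f) : TT e P 0 f = f.curryLeft e := rfl

lemma TT_succ_apply (e : E) (P : E →L[ℝ] E) (n : ℕ) (f) (v : Fin (n+1) → E) :
    TT e P (n+1) f v = f.curryLeft e v + TT e P n (f.curryLeft (P (v 0))) (Fin.tail v) := by
  rfl

lemma TT_tele (e : E) (P : E →L[ℝ] E) (ℓ : E → ℝ) (hP : ∀ x, x = P x + ℓ x • e) (n : ℕ)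
    (f : ContinuousMultilinearMap ℝ (fun _ : Fin (n+1) => E) ℝ) (x : E) :
    f (fun _ => x) - f (fun _ => P x) = ℓ x * TT e P n f (fun _ => x) := by
  have hcons : ∀ (k : ℕ) (y : E), (fun _ : Fin (k+1) => y) = Fin.cons y (fun _ => y) := by
    intro k y; ext i; refine Fin.cases ?_ (fun j => ?_) i <;> simp
  have hsplit : ∀ (k : ℕ) (g : ContinuousMultilinearMap ℝ (fun _ : Fin (k+1) => E) ℝ) (w : Fin k → E),
      g (Fin.cons x w) = g (Fin.cons (P x) w) + ℓ x * g (Fin.cons e w) := by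
    intro k g w
    have h1 : g.curryLeft x w = g.curryLeft (P x + ℓ x • e) w := by rw [← hP x]
    rw [map_add, map_smul] at h1
    simpa using h1
  induction n with
  | zero =>
    rw [TT_zero, hcons 0 x, hcons 0 (P x), hsplit]
    have : (fun _ : Fin 0 => P x) = fun _ => x := by ext i; exact i.elim0
    rw [this]
    simp [ContinuousMultilinearMap.curryLeft_apply]
  | succ n ih =>
    rw [TT_succ_apply, hcons (n+1) x, hcons (n+1) (P x), hsplit]
    have h2 := ih (f.curryLeft (P x))
    simp only [ContinuousMultilinearMap.curryLeft_apply] at h2 ⊢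
    have ht : Fin.tail (Fin.cons x (fun _ : Fin (n+1) => x) : Fin (n+2) → E) = fun _ => x := by simp
    have ht2 : Fin.tail (fun _ : Fin (n+1) => x) = fun _ => x := rfl
    rw [ht2, mul_add, ← h2]
    ring

lemma TT_norm (e : E) (P : E →L[ℝ] E) (he : ‖e‖ ≤ 1) (hP : ‖P‖ ≤ 1) (n : ℕ)
    (f : ContinuousMultilinearMap ℝ (fun _ : Fin (n+1) => E) ℝ) : ‖TT e P n f‖ ≤ (n+1) * ‖f‖ := by
  have h1 : ∀ k (g : ContinuousMultilinearMap ℝ (fun _ : Fin (k+1) => E) ℝ) (w : E), ‖g.curryLeft w‖ ≤ ‖g‖ * ‖w‖ := by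
    intro k g w
    refine (g.curryLeft.le_opNorm w).trans ?_
    rw [ContinuousMultilinearMap.curryLeft_norm]
  induction n with
  | zero =>
    rw [TT_zero]
    refine (h1 0 f e).trans ?_
    have := norm_nonneg f
    push_cast
    nlinarith
  | succ n ih =>
    apply ContinuousMultilinearMap.opNorm_le_bound (by positivity)
    intro v
    rw [TT_succ_apply]
    refine (norm_add_le _ _).trans ?_
    have ha : ‖f.curryLeft e v‖ ≤ ‖f‖ * ∏ i, ‖v i‖ := by
      refine ((f.curryLeft e).le_opNorm v).trans ?_
      gcongr
      refine (h1 _ f e).trans ?_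
      have := norm_nonneg f
      nlinarith
    have hb : ‖TT e P n (f.curryLeft (P (v 0))) (Fin.tail v)‖ ≤ (n+1) * ‖f‖ * ∏ i, ‖v i‖ := by
      refine (ContinuousMultilinearMap.le_opNorm _ _).trans ?_
      rw [Fin.prod_univ_succ]
      have hc : ‖TT e P n (f.curryLeft (P (v 0)))‖ ≤ (n+1) * ‖f‖ * ‖v 0‖ := by
        refine (ih _).trans ?_
        rw [mul_assoc]
        gcongr
        refine (h1 _ f _).trans ?_
        gcongr
        refine (P.le_opNorm _).trans ?_
        have := norm_nonneg (v 0)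
        nlinarith
      calc _ ≤ ((n+1) * ‖f‖ * ‖v 0‖) * ∏ i, ‖Fin.tail v i‖ := by gcongr
        _ = _ := by simp only [Fin.tail]; ring
    push_cast
    linarith

lemma analytic_division (e : E) (P : E →L[ℝ] E) (ℓ : E → ℝ) (hP : ∀ x, x = P x + ℓ x • e)
    (he : ‖e‖ ≤ 1) (hPn : ‖P‖ ≤ 1) {A : E → ℝ} (hA : AnalyticAt ℝ A 0) :
    ∃ ψ : E → ℝ, AnalyticAt ℝ ψ 0 ∧ ∀ᶠ x in 𝓝 0, A x - A (P x) = ℓ x * ψ x := by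
  obtain ⟨p, r, hp⟩ := hA
  set q : FormalMultilinearSeries ℝ E ℝ := fun n => TT e P n (p (n+1)) with hq
  obtain ⟨r', hr'0, hr'⟩ := ENNReal.lt_iff_exists_nnreal_btwn.1 (hp.r_pos.trans_le hp.r_le)
  have hr'p : 0 < r' := by simpa using hr'0
  obtain ⟨C, hC, hCb⟩ := p.norm_mul_pow_le_of_lt_radius hr'
  have hrad : ((r' / 2 : NNReal) : ENNReal) ≤ q.radius := by
    apply q.le_radius_of_bound (C / r')
    intro n
    have h1 : ‖q n‖ ≤ (n+1) * ‖p (n+1)‖ := TT_norm e P he hPn n _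
    have h2 := hCb (n+1)
    have h3 : ((n:ℝ)+1) ≤ 2^n := by exact_mod_cast Nat.lt_two_pow_self
    have hr0 : (0:ℝ) < r' := hr'p
    push_cast
    rw [div_pow, le_div_iff₀ hr0]
    calc ‖q n‖ * ((r':ℝ)^n / 2^n) * r' ≤ ((2:ℝ)^n * ‖p (n+1)‖) * ((r':ℝ)^n / 2^n) * r' := by
          gcongr
          refine h1.trans (by gcongr)
      _ = ‖p (n+1)‖ * r' ^ (n+1) := by
          field_simp; ring
      _ ≤ C := h2
  have hqpos : 0 < q.radius := lt_of_lt_of_le (by simpa using hr'p.ne') hrad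
  refine ⟨q.sum, ⟨q, q.hasFPowerSeriesOnBall hqpos |>.hasFPowerSeriesAt⟩, ?_⟩
  have hb1 : Metric.eball (0:E) r ∈ 𝓝 0 := Metric.eball_mem_nhds _ hp.r_pos
  have hb2 : Metric.eball (0:E) q.radius ∈ 𝓝 0 := Metric.eball_mem_nhds _ hqpos
  have hPt : Tendsto P (𝓝 0) (𝓝 0) := by simpa using P.continuous.tendsto 0
  filter_upwards [hb1, hb2, hPt hb1] with x hx1 hx2 hx3
  have s1 := hp.hasSum hx1
  have s2 := hp.hasSum hx3
  have s3 := ((q.hasFPowerSeriesOnBall hqpos).hasSum hx2).mul_left (ℓ x)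
  simp only [zero_add] at s1 s2 s3
  have s4 := s1.sub s2
  have e0 : (p 0 fun _ => x) - (p 0 fun _ => P x) = 0 := by
    have : (fun _ : Fin 0 => x) = fun _ => P x := by ext i; exact i.elim0
    rw [this, sub_self]
  rw [← hasSum_nat_add_iff' 1] at s4
  simp only [Finset.range_one, Finset.sum_singleton] at s4
  rw [e0, sub_zero] at s4
  have e1 : (fun n => (p (n+1) fun _ => x) - (p (n+1) fun _ => P x)) = fun n => ℓ x * q n (fun _ => x) := by
    ext n; exact TT_tele e P ℓ hP n _ x
  rw [e1] at s4
  exact s4.unique s3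

end Division

section Germ
variable {E : Type*} [NormedAddCommGroup E] [NormedSpace ℝ E]

lemma germ_domain {A B : E → ℝ} {a : E} (hA : AnalyticAt ℝ A a) (hB : AnalyticAt ℝ B a)
    (h : ∀ᶠ x in 𝓝 a, A x * B x = 0) : (∀ᶠ x in 𝓝 a, A x = 0) ∨ (∀ᶠ x in 𝓝 a, B x = 0) := by
  by_contra hc
  push Not at hc
  obtain ⟨h1, h2⟩ := hc
  obtain ⟨r, hr, hb⟩ := Metric.eventually_nhds_iff_ball.1 (h.and (hA.eventually_analyticAt.and hB.eventually_analyticAt))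
  obtain ⟨x, hx, hxb⟩ := (h1.and_eventually (Metric.ball_mem_nhds a hr)).exists
  have hBx : B =ᶠ[𝓝 x] 0 := by
    have hne : ∀ᶠ y in 𝓝 x, A y ≠ 0 := (hb x hxb).2.1.continuousAt.eventually_ne hx
    filter_upwards [hne, Metric.isOpen_ball.mem_nhds hxb] with y hy hyb
    exact (mul_eq_zero.1 (hb y hyb).1).resolve_left hy
  have := AnalyticOnNhd.eqOn_zero_of_preconnected_of_eventuallyEq_zero (f := B) (U := Metric.ball a r)
    (fun y hy => (hb y hy).2.2) (convex_ball a r).isPreconnected hxb hBx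
  obtain ⟨y, hy, hyb⟩ := (h2.and_eventually (Metric.ball_mem_nhds a hr)).exists
  exact hy (this hyb)

end Germ
end HLD

namespace HLD
open Set Filter Topology QDC
open scoped ContDiff

section Mono
variable {n : ℕ}

/-- monomials -/
def mono (z : Fin n → ℝ) (β : Fin n → ℕ) : ℝ := ∏ i, z i ^ β i

lemma mono_add (z : Fin n → ℝ) (β γ : Fin n → ℕ) : mono z (β + γ) = mono z β * mono z γ := by
  simp [mono, pow_add, Finset.prod_mul_distrib]

lemma mono_zero (z : Fin n → ℝ) : mono z 0 = 1 := by simp [mono]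

lemma mono_single (z : Fin n → ℝ) (i : Fin n) : mono z (Pi.single i 1) = z i := by
  unfold mono
  rw [Finset.prod_eq_single i]
  · simp
  · intro j _ hj; simp [hj]
  · simp

lemma mono_smul (z : Fin n → ℝ) (k : ℕ) (β : Fin n → ℕ) : mono z (k • β) = mono z β ^ k := by
  simp only [mono, Pi.smul_apply, smul_eq_mul, ← Finset.prod_pow]
  exact Finset.prod_congr rfl fun i _ => by rw [mul_comm, pow_mul]

lemma mono_at_zero {β : Fin n → ℕ} (h : β ≠ 0) : mono (0 : Fin n → ℝ) β = 0 := by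
  obtain ⟨i, hi⟩ := Function.ne_iff.1 h
  exact Finset.prod_eq_zero (Finset.mem_univ i) (by simpa using hi)

lemma mono_ne {z : Fin n → ℝ} {β : Fin n → ℕ} (h : ∀ i, β i ≠ 0 → z i ≠ 0) : mono z β ≠ 0 := by
  apply Finset.prod_ne_zero_iff.2
  intro i _
  by_cases hb : β i = 0
  · simp [hb]
  · exact pow_ne_zero _ (h i hb)

lemma mono_eq_zero {z : Fin n → ℝ} {β : Fin n → ℕ} {i} (h : β i ≠ 0) (hz : z i = 0) : mono z β = 0 :=
  Finset.prod_eq_zero (Finset.mem_univ i) (by simp [hz, h])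

lemma mono_analytic (β : Fin n → ℕ) (x : Fin n → ℝ) : AnalyticAt ℝ (fun z => mono z β) x := by
  unfold mono
  apply Finset.analyticAt_fun_prod
  intro i _
  exact ((ContinuousLinearMap.proj (R := ℝ) (φ := fun _ : Fin n => ℝ) i).analyticAt x).pow _

lemma coord_analytic (i : Fin n) (x : Fin n → ℝ) : AnalyticAt ℝ (fun z : Fin n → ℝ => z i) x :=
  (ContinuousLinearMap.proj (R := ℝ) (φ := fun _ : Fin n => ℝ) i).analyticAt x

lemma pi_ind {P : (Fin n → ℕ) → Prop} (h0 : P 0)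
    (h1 : ∀ α j, P α → P (α + Pi.single j 1)) (α) : P α := by
  have := finsupp_ind (P := fun α : Fin n →₀ ℕ => P (fun i => α i)) h0 (by
    intro α j h
    have h2 := h1 _ j h
    convert h2 using 1
    ext i
    simp [Finsupp.single_apply, Pi.single_apply, eq_comm]) (Finsupp.equivFunOnFinite.symm α)
  simpa using this

/-- the projection killing a coordinate -/
noncomputable def PP (i : Fin n) : (Fin n → ℝ) →L[ℝ] (Fin n → ℝ) :=
  ContinuousLinearMap.id ℝ _ - (ContinuousLinearMap.proj (R := ℝ) (φ := fun _ : Fin n => ℝ) i).smulRight (Pi.single i 1)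

lemma PP_apply (i : Fin n) (x) : PP i x = Function.update x i 0 := by
  rw [update_eq_add]
  simp only [PP, ContinuousLinearMap.sub_apply, ContinuousLinearMap.id_apply, ContinuousLinearMap.smulRight_apply,
    ContinuousLinearMap.proj_apply]
  rw [zero_sub, neg_smul, sub_eq_add_neg]

lemma PP_same (i : Fin n) (x) : PP i x i = 0 := by rw [PP_apply]; simp
lemma PP_ne (i j : Fin n) (x) (h : j ≠ i) : PP i x j = x j := by rw [PP_apply]; simp [h]

lemma coord_div (i : Fin n) {A : (Fin n → ℝ) → ℝ} (hA : AnalyticAt ℝ A 0) :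
    ∃ ψ : (Fin n → ℝ) → ℝ, AnalyticAt ℝ ψ 0 ∧ ∀ᶠ x in 𝓝 0, A x - A (PP i x) = x i * ψ x := by
  apply analytic_division (Pi.single i 1) (PP i) (fun x => x i) _ _ _ hA
  · intro x
    rw [PP_apply, update_eq_add, zero_sub, neg_smul, neg_add_cancel_right]
  · rw [pi_norm_le_iff_of_nonneg zero_le_one]
    intro j
    by_cases hj : j = i
    · subst hj; simp
    · simp [hj]
  · apply ContinuousLinearMap.opNorm_le_bound _ zero_le_one
    intro x
    rw [one_mul, pi_norm_le_iff_of_nonneg (norm_nonneg x)]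
    intro j
    by_cases hj : j = i
    · subst hj; simp [PP_same]
    · rw [PP_ne _ _ _ hj]; exact norm_le_pi_norm x j

lemma PP_tendsto (i : Fin n) : Tendsto (PP i) (𝓝 0) (𝓝 0) := by
  simpa using (PP i).continuous.tendsto 0

lemma PP_comp {A : (Fin n → ℝ) → ℝ} (hA : AnalyticAt ℝ A 0) (i : Fin n) :
    AnalyticAt ℝ (fun x => A (PP i x)) 0 :=
  AnalyticAt.comp' (g := A) (by simpa using hA) ((PP i).analyticAt 0)

lemma coord_div0 (i : Fin n) {A : (Fin n → ℝ) → ℝ} (hA : AnalyticAt ℝ A 0)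
    (h : ∀ᶠ x in 𝓝 0, A (PP i x) = 0) :
    ∃ ψ : (Fin n → ℝ) → ℝ, AnalyticAt ℝ ψ 0 ∧ ∀ᶠ x in 𝓝 0, A x = x i * ψ x := by
  obtain ⟨ψ, hψ, h2⟩ := coord_div i hA
  refine ⟨ψ, hψ, ?_⟩
  filter_upwards [h, h2] with x h1 h2
  rw [h1, sub_zero] at h2; exact h2

/-- monomial times unit -/
def MU (F : (Fin n → ℝ) → ℝ) : Prop :=
  ∃ (β : Fin n → ℕ) (u : (Fin n → ℝ) → ℝ), AnalyticAt ℝ u 0 ∧ u 0 ≠ 0 ∧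
    ∀ᶠ z in 𝓝 0, F z = u z * mono z β

lemma MU.congr {F G : (Fin n → ℝ) → ℝ} (h : MU F) (e : ∀ᶠ z in 𝓝 0, G z = F z) : MU G := by
  obtain ⟨β, u, h1, h2, h3⟩ := h
  refine ⟨β, u, h1, h2, ?_⟩
  filter_upwards [h3, e] with z a b
  rw [b, a]

lemma MU.mul {F G : (Fin n → ℝ) → ℝ} (hF : MU F) (hG : MU G) : MU (fun z => F z * G z) := by
  obtain ⟨β, u, h1, h2, h3⟩ := hF
  obtain ⟨γ, v, k1, k2, k3⟩ := hG
  refine ⟨β + γ, fun z => u z * v z, h1.mul k1, mul_ne_zero h2 k2, ?_⟩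
  filter_upwards [h3, k3] with z a b
  rw [b, a, mono_add]; ring

lemma MU.unit {u : (Fin n → ℝ) → ℝ} (h1 : AnalyticAt ℝ u 0) (h2 : u 0 ≠ 0) : MU u :=
  ⟨0, u, h1, h2, Eventually.of_forall fun z => by rw [mono_zero, mul_one]⟩

lemma MU.coord (i : Fin n) : MU (fun z => z i) :=
  ⟨Pi.single i 1, fun _ => 1, analyticAt_const, one_ne_zero, Eventually.of_forall fun z => by
    rw [mono_single, one_mul]⟩

lemma MU.pow {F : (Fin n → ℝ) → ℝ} (hF : MU F) (k : ℕ) : MU (fun z => F z ^ k) := by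
  induction k with
  | zero => simpa using MU.unit (analyticAt_const) one_ne_zero
  | succ k ih => simp only [pow_succ]; exact ih.mul hF

lemma MU.prod {ι : Type*} (s : Finset ι) {F : ι → (Fin n → ℝ) → ℝ} (hF : ∀ i ∈ s, MU (F i)) :
    MU (fun z => ∏ i ∈ s, F i z) := by
  classical
  induction s using Finset.induction_on with
  | empty => simpa using MU.unit (analyticAt_const) one_ne_zero
  | insert a s ha ih =>
    simp only [Finset.prod_insert ha]
    exact (hF a (by simp)).mul (ih fun i hi => hF i (by simp [hi]))

lemma MU.analytic {F : (Fin n → ℝ) → ℝ} (hF : MU F) : AnalyticAt ℝ F 0 := by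
  obtain ⟨β, u, h1, h2, h3⟩ := hF
  exact (h1.mul (mono_analytic β 0)).congr (h3.mono fun z hz => hz.symm)

/-- germ is not zero -/
def NZ (F : (Fin n → ℝ) → ℝ) : Prop := AnalyticAt ℝ F 0 ∧ ¬ ∀ᶠ z in 𝓝 0, F z = 0

lemma NZ.mul {F G : (Fin n → ℝ) → ℝ} (hF : NZ F) (hG : NZ G) : NZ (fun z => F z * G z) :=
  ⟨hF.1.mul hG.1, fun h => (germ_domain hF.1 hG.1 h).elim hF.2 hG.2⟩

lemma NZ.prod {ι : Type*} (s : Finset ι) {F : ι → (Fin n → ℝ) → ℝ} (hF : ∀ i ∈ s, NZ (F i)) :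
    NZ (fun z => ∏ i ∈ s, F i z) := by
  classical
  induction s using Finset.induction_on with
  | empty => simpa using ⟨analyticAt_const, fun h => one_ne_zero h.self_of_nhds⟩
  | insert a s ha ih =>
    simp only [Finset.prod_insert ha]
    exact (hF a (by simp)).mul (ih fun i hi => hF i (by simp [hi]))

/-- small test point -/
lemma test_pt {p : (Fin n → ℝ) → Prop} (h : ∀ᶠ z in 𝓝 (0 : Fin n → ℝ), p z) (S : Finset (Fin n)) :
    ∃ z, p z ∧ (∀ i ∈ S, z i = 0) ∧ (∀ i ∉ S, z i ≠ 0) := by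
  classical
  have ht : Tendsto (fun s : ℝ => fun i : Fin n => if i ∈ S then 0 else s) (𝓝[≠] 0) (𝓝 0) := by
    have : Continuous (fun s : ℝ => fun i : Fin n => if i ∈ S then (0:ℝ) else s) := by
      apply continuous_pi; intro i; split_ifs <;> fun_prop
    have h := (this.tendsto 0).mono_left (nhdsWithin_le_nhds (s := {0}ᶜ))
    convert h using 2
    ext i; simp
  obtain ⟨s, hs, hs0⟩ := ((ht.eventually h).and self_mem_nhdsWithin).exists
  refine ⟨_, hs, ?_, ?_⟩
  · intro i hi; simp [hi]
  · intro i hi; simpa [hi] using hs0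

lemma MU.nz {F : (Fin n → ℝ) → ℝ} (hF : MU F) : NZ F := by
  refine ⟨hF.analytic, fun h => ?_⟩
  obtain ⟨β, u, h1, h2, h3⟩ := hF
  obtain ⟨z, ⟨hz1, hz2, hz3⟩, -, hz⟩ := test_pt (h.and (h3.and (h1.continuousAt.eventually_ne h2))) ∅
  rw [hz1] at hz2
  exact mul_ne_zero hz3 (mono_ne fun i _ => hz i (by simp)) hz2.symm

lemma MU.comp {F : (Fin n → ℝ) → ℝ} (hF : MU F) {k : ℕ} {π : (Fin k → ℝ) → (Fin n → ℝ)}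
    (hπ : AnalyticAt ℝ π 0) (h0 : π 0 = 0) (hc : ∀ i, MU (fun z => π z i)) : MU (fun z => F (π z)) := by
  obtain ⟨β, u, h1, h2, h3⟩ := hF
  have h4 : MU (fun z => u (π z) * mono (π z) β) := by
    refine (MU.unit (AnalyticAt.comp' (g := u) (by rwa [h0]) hπ) (by rwa [h0])).mul ?_
    exact MU.prod _ fun i _ => (hc i).pow _
  apply h4.congr
  have : Tendsto π (𝓝 0) (𝓝 0) := by simpa [ContinuousAt, h0] using hπ.continuousAt
  exact this.eventually h3

lemma factor (β : Fin n → ℕ) : ∀ {A B u : (Fin n → ℝ) → ℝ}, AnalyticAt ℝ A 0 → AnalyticAt ℝ B 0 →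
    AnalyticAt ℝ u 0 → u 0 ≠ 0 → (∀ᶠ z in 𝓝 0, A z * B z = u z * mono z β) → MU A := by
  induction β using pi_ind with
  | h0 =>
    intro A B u hA hB hu hu0 h
    apply MU.unit hA
    have := h.self_of_nhds
    rw [mono_zero, mul_one] at this
    intro hc
    rw [hc, zero_mul] at this
    exact hu0 this.symm
  | h1 β i ih =>
    intro A B u hA hB hu hu0 h
    have hz : ∀ᶠ z in 𝓝 0, A (PP i z) * B (PP i z) = 0 := by
      filter_upwards [(PP_tendsto i).eventually h] with z hz
      rw [hz, mono_add, mono_single, PP_same]; ring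
    have hzi : ¬ ∀ᶠ z : Fin n → ℝ in 𝓝 0, z i = 0 := (MU.coord i).nz.2
    rcases germ_domain (PP_comp hA i) (PP_comp hB i) hz with h1 | h1
    · obtain ⟨ψ, hψ, h2⟩ := coord_div0 i hA h1
      have h3 : ∀ᶠ z in 𝓝 (0 : Fin n → ℝ), z i * (ψ z * B z - u z * mono z β) = 0 := by
        filter_upwards [h, h2] with z a b
        rw [b, mono_add, mono_single] at a
        linear_combination a
      have h4 := (germ_domain (coord_analytic i 0) ((hψ.mul hB).sub (hu.mul (mono_analytic β 0))) h3).resolve_left hzi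
      have h5 := ih hψ hB hu hu0 (h4.mono fun z hz => sub_eq_zero.1 hz)
      exact ((MU.coord i).mul h5).congr h2
    · obtain ⟨ψ, hψ, h2⟩ := coord_div0 i hB h1
      have h3 : ∀ᶠ z in 𝓝 (0 : Fin n → ℝ), z i * (A z * ψ z - u z * mono z β) = 0 := by
        filter_upwards [h, h2] with z a b
        rw [b, mono_add, mono_single] at a
        linear_combination a
      have h4 := (germ_domain (coord_analytic i 0) ((hA.mul hψ).sub (hu.mul (mono_analytic β 0))) h3).resolve_left hzi
      exact ih hA hψ hu hu0 (h4.mono fun z hz => sub_eq_zero.1 hz)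

lemma MU.factor_left {A B : (Fin n → ℝ) → ℝ} (hA : AnalyticAt ℝ A 0) (hB : AnalyticAt ℝ B 0)
    (h : MU (fun z => A z * B z)) : MU A := by
  obtain ⟨β, u, h1, h2, h3⟩ := h
  exact factor β hA hB h1 h2 h3

lemma MU.factor_right {A B : (Fin n → ℝ) → ℝ} (hA : AnalyticAt ℝ A 0) (hB : AnalyticAt ℝ B 0)
    (h : MU (fun z => A z * B z)) : MU B := by
  apply MU.factor_left hB hA
  simpa [mul_comm] using h

lemma MU.factor_prod {ι : Type*} (s : Finset ι) {F : ι → (Fin n → ℝ) → ℝ} (hF : ∀ i ∈ s, AnalyticAt ℝ (F i) 0)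
    (h : MU (fun z => ∏ i ∈ s, F i z)) : ∀ i ∈ s, MU (F i) := by
  classical
  intro i hi
  simp only [← Finset.mul_prod_erase s _ hi] at h
  refine MU.factor_left (hF i hi) ?_ h
  apply Finset.analyticAt_fun_prod
  intro j hj
  exact hF j (Finset.mem_of_mem_erase hj)

lemma compar_aux {α β : Fin n → ℕ} {u v : (Fin n → ℝ) → ℝ} (hu : AnalyticAt ℝ u 0) (hv : AnalyticAt ℝ v 0)
    (hu0 : u 0 ≠ 0) (hv0 : v 0 ≠ 0) (hd : ∀ i, α i = 0 ∨ β i = 0) (hα : α ≠ 0) (hβ : β ≠ 0)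
    (h : (∀ᶠ z in 𝓝 0, u z * mono z α - v z * mono z β = 0) ∨ MU (fun z => u z * mono z α - v z * mono z β)) :
    False := by
  classical
  -- exists a coordinate set
  have key : ∃ T : Finset (Fin n), T.card ≤ 1 ∧ ∀ᶠ z in 𝓝 (0 : Fin n → ℝ), (∃ k ∈ T, z k = 0) ∨ T = ∅ → u z * mono z α - v z * mono z β = 0 := by
    rcases h with h | ⟨δ, w, hw, hw0, h⟩
    · exact ⟨∅, by simp, h.mono fun z hz _ => hz⟩
    · have h0 := h.self_of_nhds
      beta_reduce at h0 h
      rw [mono_at_zero hα, mono_at_zero hβ] at h0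
      have : δ ≠ 0 := by
        rintro rfl
        rw [mono_zero] at h0
        simp at h0; exact hw0 h0.symm
      obtain ⟨k, hk⟩ := Function.ne_iff.1 this
      refine ⟨{k}, by simp, ?_⟩
      filter_upwards [h] with z hz hzk
      have hzk : z k = 0 := by simpa using hzk
      rw [hz, mono_eq_zero hk hzk, mul_zero]
  obtain ⟨T, hT, hTz⟩ := key
  have hαβ : (∀ k ∈ T, α k = 0) ∨ (∀ k ∈ T, β k = 0) := by
    have hne : Nonempty (Fin n) := ⟨(Function.ne_iff.1 hα).choose⟩
    rcases Finset.card_le_one_iff_subset_singleton.1 hT with ⟨k, hk⟩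
    rcases hd k with h | h
    · left; intro j hj; have := Finset.mem_singleton.1 (hk hj); rwa [this]
    · right; intro j hj; have := Finset.mem_singleton.1 (hk hj); rwa [this]
  have hun := hu.continuousAt.eventually_ne hu0
  have hvn := hv.continuousAt.eventually_ne hv0
  have hTT : ∀ z : Fin n → ℝ, (∀ k ∈ T, z k = 0) → (∃ k ∈ T, z k = 0) ∨ T = ∅ := by
    intro z hz
    rcases T.eq_empty_or_nonempty with h | ⟨k, hk⟩
    · exact Or.inr h
    · exact Or.inl ⟨k, hk, hz k hk⟩
  rcases hαβ with hk | hk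
  · obtain ⟨i, hi⟩ := Function.ne_iff.1 hβ
    obtain ⟨z, ⟨hz1, hz2⟩, hz0, hzn⟩ := test_pt (hTz.and hun) (T ∪ Finset.univ.filter (fun j => β j ≠ 0))
    have := hz1 (hTT z fun k hk => hz0 k (by simp [hk]))
    rw [mono_eq_zero hi (hz0 i (by simpa using Or.inr hi)), mul_zero, sub_zero] at this
    refine mul_ne_zero hz2 (mono_ne fun j hj => hzn j ?_) this
    simp only [Finset.mem_union, Finset.mem_filter, Finset.mem_univ, true_and, not_or, not_not]
    exact ⟨fun hjT => hj (hk j hjT), (hd j).resolve_left hj⟩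
  · obtain ⟨i, hi⟩ := Function.ne_iff.1 hα
    obtain ⟨z, ⟨hz1, hz2⟩, hz0, hzn⟩ := test_pt (hTz.and hvn) (T ∪ Finset.univ.filter (fun j => α j ≠ 0))
    have := hz1 (hTT z fun k hk => hz0 k (by simp [hk]))
    rw [mono_eq_zero hi (hz0 i (by simpa using Or.inr hi)), mul_zero, zero_sub, neg_eq_zero] at this
    refine mul_ne_zero hz2 (mono_ne fun j hj => hzn j ?_) this
    simp only [Finset.mem_union, Finset.mem_filter, Finset.mem_univ, true_and, not_or, not_not]
    exact ⟨fun hjT => hj (hk j hjT), (hd j).resolve_right hj⟩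

lemma compar {α β : Fin n → ℕ} {u v F G : (Fin n → ℝ) → ℝ} (hu : AnalyticAt ℝ u 0) (hv : AnalyticAt ℝ v 0)
    (hu0 : u 0 ≠ 0) (hv0 : v 0 ≠ 0) (hF : ∀ᶠ z in 𝓝 0, F z = u z * mono z α) (hG : ∀ᶠ z in 𝓝 0, G z = v z * mono z β)
    (h : (∀ᶠ z in 𝓝 0, F z - G z = 0) ∨ MU (fun z => F z - G z)) : α ≤ β ∨ β ≤ α := by
  by_contra hc
  push Not at hc
  set μ : Fin n → ℕ := fun i => min (α i) (β i) with hμ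
  have hα : α = μ + (α - μ) := by ext i; simp [hμ]
  have hβ : β = μ + (β - μ) := by ext i; simp [hμ]
  have e : ∀ᶠ z in 𝓝 0, F z - G z = mono z μ * (u z * mono z (α - μ) - v z * mono z (β - μ)) := by
    filter_upwards [hF, hG] with z h1 h2
    rw [h1, h2, hα, hβ, mono_add, mono_add, ← hα, ← hβ]; ring
  have hDa : AnalyticAt ℝ (fun z => u z * mono z (α - μ) - v z * mono z (β - μ)) 0 :=
    (hu.mul (mono_analytic _ 0)).sub (hv.mul (mono_analytic _ 0))
  refine compar_aux (α := α - μ) (β := β - μ) hu hv hu0 hv0 ?_ ?_ ?_ ?_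
  · intro i; simp [hμ]; omega
  · intro h0
    apply hc.1
    rw [hα, h0, add_zero]
    intro i; simp [hμ]
  · intro h0
    apply hc.2
    rw [hβ, h0, add_zero]
    intro i; simp [hμ]
  · rcases h with h | h
    · left
      have hz : ∀ᶠ z in 𝓝 0, mono z μ * (u z * mono z (α - μ) - v z * mono z (β - μ)) = 0 := by
        filter_upwards [e, h] with z h1 h2; rw [← h1, h2]
      refine (germ_domain (mono_analytic μ 0) hDa hz).resolve_left ?_
      have : MU (fun z : Fin n → ℝ => mono z μ) := ⟨μ, fun _ => 1, analyticAt_const, one_ne_zero, by simp⟩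
      exact this.nz.2
    · right
      exact MU.factor_right (mono_analytic μ 0) hDa (h.congr (e.mono fun z hz => hz.symm))

end Mono
end HLD

namespace HLD
open Set Filter Topology QDC
open scoped ContDiff

section Cn
variable {m : ℕ}

/-- cons -/
def cn (t : ℝ) (x : Fin m → ℝ) : Fin (m+1) → ℝ := Fin.cons t x
/-- tail -/
def tl (x : Fin (m+1) → ℝ) : Fin m → ℝ := fun i => x i.succ

@[simp] lemma cn_zero (t : ℝ) (x : Fin m → ℝ) : cn t x 0 = t := rfl
@[simp] lemma cn_succ (t : ℝ) (x : Fin m → ℝ) (i : Fin m) : cn t x i.succ = x i := rfl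
@[simp] lemma tl_cn (t : ℝ) (x : Fin m → ℝ) : tl (cn t x) = x := rfl
@[simp] lemma cn_tl (x : Fin (m+1) → ℝ) : cn (x 0) (tl x) = x := by
  ext i; refine Fin.cases rfl (fun j => rfl) i
@[simp] lemma tl_zero : tl (0 : Fin (m+1) → ℝ) = 0 := rfl
@[simp] lemma cn_zero_zero : cn 0 (0 : Fin m → ℝ) = 0 := by
  ext i; refine Fin.cases rfl (fun j => rfl) i

lemma analyticAt_pi' {E : Type*} [NormedAddCommGroup E] [NormedSpace ℝ E] {k : ℕ} {f : E → (Fin k → ℝ)} {a : E}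
    (h : ∀ i, AnalyticAt ℝ (fun z => f z i) a) : AnalyticAt ℝ f a :=
  analyticAt_pi_iff.2 h

lemma cn_analytic {E : Type*} [NormedAddCommGroup E] [NormedSpace ℝ E] {f : E → ℝ} {g : E → (Fin m → ℝ)} {a : E}
    (hf : AnalyticAt ℝ f a) (hg : AnalyticAt ℝ g a) : AnalyticAt ℝ (fun z => cn (f z) (g z)) a := by
  apply analyticAt_pi'
  intro i
  refine Fin.cases hf (fun j => ?_) i
  exact (analyticAt_pi_iff.1 hg) j

lemma tl_analytic {E : Type*} [NormedAddCommGroup E] [NormedSpace ℝ E] {g : E → (Fin (m+1) → ℝ)} {a : E}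
    (hg : AnalyticAt ℝ g a) : AnalyticAt ℝ (fun z => tl (g z)) a := by
  apply analyticAt_pi'
  intro i
  exact (analyticAt_pi_iff.1 hg) i.succ

lemma cn_tendsto {ι : Type*} {l : Filter ι} {f : ι → ℝ} {g : ι → (Fin m → ℝ)}
    (hf : Tendsto f l (𝓝 0)) (hg : Tendsto g l (𝓝 0)) : Tendsto (fun i => cn (f i) (g i)) l (𝓝 0) := by
  rw [tendsto_pi_nhds]
  intro i
  refine Fin.cases hf (fun j => ?_) i
  exact (tendsto_pi_nhds.1 hg) j

lemma tl_tendsto {ι : Type*} {l : Filter ι} {g : ι → (Fin (m+1) → ℝ)}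
    (hg : Tendsto g l (𝓝 0)) : Tendsto (fun i => tl (g i)) l (𝓝 0) := by
  rw [tendsto_pi_nhds] at hg ⊢
  intro i
  exact hg i.succ

lemma tl_tendsto' : Tendsto (tl : (Fin (m+1) → ℝ) → _) (𝓝 0) (𝓝 0) := tl_tendsto tendsto_id

lemma mono_cons (z : Fin (m+1) → ℝ) (k : ℕ) (β : Fin m → ℕ) :
    mono z (Fin.cons k β : Fin (m+1) → ℕ) = z 0 ^ k * mono (tl z) β := by
  simp [mono, Fin.prod_univ_succ, tl]

lemma MU.tl {h : (Fin m → ℝ) → ℝ} (hh : MU h) : MU (fun z : Fin (m+1) → ℝ => h (tl z)) := by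
  obtain ⟨β, u, h1, h2, h3⟩ := hh
  refine ⟨(Fin.cons 0 β : Fin (m+1) → ℕ), fun z => u (HLD.tl z), ?_, h2, ?_⟩
  · exact AnalyticAt.comp' (g := u) (by simpa using h1) (tl_analytic analyticAt_id)
  · filter_upwards [tl_tendsto'.eventually h3] with z hz
    rw [hz, mono_cons, pow_zero, one_mul]

end Cn

section LUdef
variable {I : Type*} (U : Ultrafilter I)

/-- local uniformization along an ultrafilter -/
def LU {n : ℕ} (F : (Fin n → ℝ) → ℝ) (X : I → (Fin n → ℝ)) : Prop :=
  ∃ π : (Fin n → ℝ) → (Fin n → ℝ), AnalyticAt ℝ π 0 ∧ π 0 = 0 ∧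
    ∃ Y : I → (Fin n → ℝ), Tendsto Y U (𝓝 0) ∧ (∀ᶠ i in (U : Filter I), π (Y i) = X i) ∧
    MU (fun z => F (π z))

variable {U}

lemma LU.of_MU {n : ℕ} {F : (Fin n → ℝ) → ℝ} (h : MU F) {X : I → (Fin n → ℝ)}
    (hX : Tendsto X U (𝓝 0)) : LU U F X :=
  ⟨id, analyticAt_id, rfl, X, hX, by simp, h⟩

lemma ev_comp {E G : Type*} [NormedAddCommGroup E] [NormedSpace ℝ E] [NormedAddCommGroup G] [NormedSpace ℝ G]
    {π : E → G} (hπ : AnalyticAt ℝ π 0) (h0 : π 0 = 0) {p : G → Prop}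
    (h : ∀ᶠ z in 𝓝 0, p z) : ∀ᶠ z in 𝓝 0, p (π z) := by
  have : Tendsto π (𝓝 0) (𝓝 0) := by simpa [ContinuousAt, h0] using hπ.continuousAt
  exact this.eventually h

lemma an_comp {E G : Type*} [NormedAddCommGroup E] [NormedSpace ℝ E] [NormedAddCommGroup G] [NormedSpace ℝ G]
    {π : E → G} (hπ : AnalyticAt ℝ π 0) (h0 : π 0 = 0) {f : G → ℝ} (hf : AnalyticAt ℝ f 0) :
    AnalyticAt ℝ (fun z => f (π z)) 0 := AnalyticAt.comp' (g := f) (by rwa [h0]) hπ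

lemma LU.congr {n : ℕ} {F G : (Fin n → ℝ) → ℝ} {X : I → (Fin n → ℝ)} (h : LU U F X)
    (e : ∀ᶠ z in 𝓝 0, G z = F z) : LU U G X := by
  obtain ⟨π, h1, h2, Y, h3, h4, h5⟩ := h
  exact ⟨π, h1, h2, Y, h3, h4, h5.congr (ev_comp h1 h2 e)⟩

lemma LU.trans {n : ℕ} {F : (Fin n → ℝ) → ℝ} {X : I → (Fin n → ℝ)} {π : (Fin n → ℝ) → (Fin n → ℝ)}
    (hπ : AnalyticAt ℝ π 0) (h0 : π 0 = 0) {Y : I → (Fin n → ℝ)}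
    (e : ∀ᶠ i in (U : Filter I), π (Y i) = X i) (h : LU U (fun z => F (π z)) Y) : LU U F X := by
  obtain ⟨π', h1, h2, Y', h3, h4, h5⟩ := h
  refine ⟨fun z => π (π' z), AnalyticAt.comp' (by rwa [h2]) h1, by beta_reduce; rw [h2, h0], Y', h3, ?_, h5⟩
  filter_upwards [e, h4] with i a b
  rw [b, a]

lemma ultra_lim {f : I → ℝ} {C : ℝ} (h : ∀ᶠ i in (U : Filter I), |f i| ≤ C) : ∃ c, Tendsto f U (𝓝 c) := by
  have : ∀ᶠ i in (U : Filter I), f i ∈ Icc (-C) C := h.mono fun i hi => abs_le.1 hi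
  obtain ⟨c, -, hc⟩ := (isCompact_Icc (a := -C) (b := C)).ultrafilter_le_nhds (U.map f) (by
    rw [le_principal_iff]; exact this)
  exact ⟨c, hc⟩


/-- toric lemma -/
lemma toric {m : ℕ} (γ : Fin m → ℕ) {C : ℝ} (hC : 0 < C) : ∀ {X : I → (Fin (m+1) → ℝ)}, Tendsto X U (𝓝 0) →
    (∀ᶠ i in (U : Filter I), C * |mono (tl (X i)) γ| < |X i 0|) →
    ∃ π : (Fin (m+1) → ℝ) → (Fin (m+1) → ℝ), AnalyticAt ℝ π 0 ∧ π 0 = 0 ∧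
    ∃ Y : I → (Fin (m+1) → ℝ), Tendsto Y U (𝓝 0) ∧ (∀ᶠ i in (U : Filter I), π (Y i) = X i) ∧
    (∀ j, MU (fun z => π z j)) ∧ ∃ ρ : (Fin (m+1) → ℝ) → ℝ, AnalyticAt ℝ ρ 0 ∧
      ∀ᶠ z in 𝓝 0, mono (tl (π z)) γ = π z 0 * ρ z := by
  induction γ using pi_ind with
  | h0 =>
    intro X hX h
    exfalso
    have h0 : Tendsto (fun i => |X i 0|) U (𝓝 0) := by
      have := (tendsto_pi_nhds.1 hX 0).abs
      simpa using this
    obtain ⟨i, hi1, hi2⟩ := (h.and (h0.eventually (gt_mem_nhds hC))).exists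
    rw [mono_zero, abs_one, mul_one] at hi1
    linarith
  | h1 γ j ih =>
    intro X hX h
    have hX0 : Tendsto (fun i => X i 0) U (𝓝 0) := tendsto_pi_nhds.1 hX 0
    have hXt : Tendsto (fun i => tl (X i)) U (𝓝 0) := tl_tendsto hX
    have ht : ∀ᶠ i in (U : Filter I), X i 0 ≠ 0 := by
      filter_upwards [h] with i hi
      have : 0 < |X i 0| := lt_of_le_of_lt (by positivity) hi
      exact abs_pos.1 this
    have hid : AnalyticAt ℝ (fun z : Fin (m+1) → ℝ => z) 0 := analyticAt_id
    rcases Ultrafilter.eventually_or.1 (Eventually.of_forall (f := (U : Filter I)) fun i => le_or_gt |tl (X i) j| |X i 0|) with hc | hc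
    · -- x_j = t s
      obtain ⟨s0, hs0⟩ := ultra_lim (U := U) (f := fun i => tl (X i) j / X i 0) (C := 1) (by
        filter_upwards [hc] with i hi
        rw [abs_div]
        exact div_le_one_of_le₀ hi (abs_nonneg _))
      set π : (Fin (m+1) → ℝ) → (Fin (m+1) → ℝ) := fun z => cn (z 0) (Function.update (tl z) j (z 0 * (s0 + z j.succ))) with hπ
      have hπj : ∀ z, tl (π z) j = z 0 * (s0 + z j.succ) := by intro z; simp [hπ]
      have hπk : ∀ z k, k ≠ j → tl (π z) k = z k.succ := by intro z k hk; simp [hπ, hk, tl]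
      have hs : AnalyticAt ℝ (fun z : Fin (m+1) → ℝ => s0 + z j.succ) 0 := analyticAt_const.add (coord_analytic _ 0)
      have hπa : AnalyticAt ℝ π 0 := by
        apply analyticAt_pi'
        intro i
        refine Fin.cases (coord_analytic 0 0) (fun k => ?_) i
        by_cases hk : k = j
        · subst hk
          have : (fun z => π z k.succ) = fun z => z 0 * (s0 + z k.succ) := by ext z; exact hπj z
          rw [this]
          exact (coord_analytic _ 0).mul hs
        · have : (fun z => π z k.succ) = fun z => z k.succ := by ext z; exact hπk z k hk
          rw [this]
          exact coord_analytic _ 0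
      refine ⟨π, hπa, ?_, fun i => cn (X i 0) (Function.update (tl (X i)) j (tl (X i) j / X i 0 - s0)), ?_, ?_, ?_,
        fun z => mono (tl (π z)) γ * (s0 + z j.succ), ?_, ?_⟩
      · ext i
        refine Fin.cases rfl (fun k => ?_) i
        by_cases hk : k = j
        · subst hk; exact (hπj 0).trans (by simp)
        · exact hπk 0 k hk
      · apply cn_tendsto hX0
        rw [tendsto_pi_nhds]
        intro k
        by_cases hk : k = j
        · subst hk
          have := hs0.sub_const s0
          simpa using this
        · simpa [hk] using tendsto_pi_nhds.1 hXt k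
      · filter_upwards [ht] with i hi
        ext k
        refine Fin.cases rfl (fun k => ?_) k
        by_cases hk : k = j
        · subst hk
          refine (hπj _).trans ?_
          simp only [cn_zero, cn_succ, Function.update_self, tl]
          field_simp
          ring
        · refine (hπk _ k hk).trans ?_
          simp [hk, tl]
      · intro k
        refine Fin.cases (MU.coord 0) (fun k => ?_) k
        by_cases hk : k = j
        · subst hk
          have : (fun z => π z k.succ) = fun z => z 0 * (s0 + z k.succ) := by ext z; exact hπj z
          rw [this]
          refine (MU.coord 0).mul ?_
          by_cases h0 : s0 = 0
          · simp only [h0, zero_add]; exact MU.coord _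
          · exact MU.unit hs (by simpa using h0)
        · have : (fun z => π z k.succ) = fun z => z k.succ := by ext z; exact hπk z k hk
          rw [this]
          exact MU.coord _
      · exact (AnalyticAt.comp' (g := fun z => mono z γ) (mono_analytic _ _) (tl_analytic hπa)).mul hs
      · filter_upwards with z
        rw [mono_add, mono_single, hπj]
        simp only [hπ, cn_zero]
        ring
    · -- t = x_j s
      have hxj : ∀ᶠ i in (U : Filter I), tl (X i) j ≠ 0 := by
        filter_upwards [hc] with i hi
        exact abs_pos.1 (lt_of_le_of_lt (abs_nonneg _) hi)
      obtain ⟨s0, hs0⟩ := ultra_lim (U := U) (f := fun i => X i 0 / tl (X i) j) (C := 1) (by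
        filter_upwards [hc] with i hi
        rw [abs_div]
        exact div_le_one_of_le₀ hi.le (abs_nonneg _))
      set π : (Fin (m+1) → ℝ) → (Fin (m+1) → ℝ) := fun z => cn (z j.succ * (s0 + z 0)) (tl z) with hπ
      have hs : AnalyticAt ℝ (fun z : Fin (m+1) → ℝ => s0 + z 0) 0 := analyticAt_const.add (coord_analytic _ 0)
      have hπa : AnalyticAt ℝ π 0 := cn_analytic ((coord_analytic _ 0).mul hs) (tl_analytic hid)
      have hπ0 : π 0 = 0 := by simp [hπ]
      set Y : I → (Fin (m+1) → ℝ) := fun i => cn (X i 0 / tl (X i) j - s0) (tl (X i)) with hY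
      have hYt : Tendsto Y U (𝓝 0) := cn_tendsto (by simpa using hs0.sub_const s0) hXt
      have hYX : ∀ᶠ i in (U : Filter I), π (Y i) = X i := by
        filter_upwards [hxj] with i hi
        simp only [hπ, hY, cn_zero, cn_succ, tl_cn, add_sub_cancel]
        rw [mul_div_cancel₀ _ hi, cn_tl]
      by_cases h0 : s0 = 0
      · have hcond : ∀ᶠ i in (U : Filter I), C * |mono (tl (Y i)) γ| < |Y i 0| := by
          filter_upwards [h, hxj] with i hi hx
          simp only [hY, tl_cn, cn_zero, h0, sub_zero, abs_div]
          rw [mono_add, mono_single, abs_mul] at hi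
          rw [lt_div_iff₀ (abs_pos.2 hx)]
          linarith
        obtain ⟨π', hπ'a, hπ'0, Y', hY', hYY, hMU, ρ, hρ, hρe⟩ := ih hYt hcond
        refine ⟨fun z => π (π' z), AnalyticAt.comp' (by rwa [hπ'0]) hπ'a, by beta_reduce; rw [hπ'0, hπ0], Y', hY', ?_, ?_, ρ, hρ, ?_⟩
        · filter_upwards [hYX, hYY] with i a b
          rw [b, a]
        · intro k
          refine Fin.cases ?_ (fun k => ?_) k
          · simp only [hπ, cn_zero, h0, zero_add]
            exact (hMU _).mul (hMU _)
          · exact hMU k.succ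
        · filter_upwards [hρe] with z hz
          simp only [hπ, cn_zero, h0, zero_add, tl_cn]
          rw [mono_add, mono_single, hz]
          simp only [tl]; ring
      · refine ⟨π, hπa, hπ0, Y, hYt, hYX, ?_, fun z => mono (tl z) γ / (s0 + z 0), ?_, ?_⟩
        · intro k
          refine Fin.cases ?_ (fun k => ?_) k
          · exact (MU.coord _).mul (MU.unit hs (by simpa using h0))
          · exact MU.coord k.succ
        · exact (AnalyticAt.comp' (g := fun z => mono z γ) (mono_analytic _ _) (tl_analytic hid)).div hs (by simpa using h0)
        · have : ∀ᶠ z : Fin (m+1) → ℝ in 𝓝 0, s0 + z 0 ≠ 0 := hs.continuousAt.eventually_ne (by simpa using h0)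
          filter_upwards [this] with z hz
          simp only [hπ, tl_cn, cn_zero]
          rw [mono_add, mono_single]
          simp only [tl]
          field_simp

end LUdef
end HLD

namespace HLD
open Set Filter Topology QDC
open scoped ContDiff

section DD
variable {m : ℕ}

/-- derivative in the zeroth coordinate -/
noncomputable def D0 (Q : (Fin (m+1) → ℝ) → ℝ) : (Fin (m+1) → ℝ) → ℝ := pd (0 : Fin (m+1)) Q

lemma D0_an {Q : (Fin (m+1) → ℝ) → ℝ} {x} (h : AnalyticAt ℝ Q x) : AnalyticAt ℝ (D0 Q) x := by
  have := h.fderiv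
  exact (ContinuousLinearMap.apply ℝ ℝ (Pi.single (0 : Fin (m+1)) (1:ℝ))).analyticAt _ |>.comp' this

lemma D0_it_an {Q : (Fin (m+1) → ℝ) → ℝ} {x} (h : AnalyticAt ℝ Q x) (k : ℕ) : AnalyticAt ℝ (D0^[k] Q) x := by
  induction k with
  | zero => exact h
  | succ k ih => rw [Function.iterate_succ_apply']; exact D0_an ih

lemma D0_congr {P Q : (Fin (m+1) → ℝ) → ℝ} {x} (h : ∀ᶠ z in 𝓝 x, P z = Q z) : ∀ᶠ z in 𝓝 x, D0 P z = D0 Q z := by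
  have h' : P =ᶠ[𝓝 x] Q := h
  filter_upwards [h'.fderiv (𝕜 := ℝ)] with z hz
  simp only [D0, pd, hz]

lemma D0_add {P Q : (Fin (m+1) → ℝ) → ℝ} {x} (hP : AnalyticAt ℝ P x) (hQ : AnalyticAt ℝ Q x) :
    ∀ᶠ z in 𝓝 x, D0 (fun z => P z + Q z) z = D0 P z + D0 Q z := by
  filter_upwards [hP.eventually_analyticAt, hQ.eventually_analyticAt] with z h1 h2
  simp only [D0, pd]
  rw [fderiv_fun_add h1.differentiableAt h2.differentiableAt]; rfl

lemma D0_mul {P Q : (Fin (m+1) → ℝ) → ℝ} {x} (hP : AnalyticAt ℝ P x) (hQ : AnalyticAt ℝ Q x) :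
    ∀ᶠ z in 𝓝 x, D0 (fun z => P z * Q z) z = P z * D0 Q z + Q z * D0 P z := by
  filter_upwards [hP.eventually_analyticAt, hQ.eventually_analyticAt] with z h1 h2
  simp only [D0, pd]
  rw [fderiv_fun_mul h1.differentiableAt h2.differentiableAt]; rfl

lemma D0_coord (x : Fin (m+1) → ℝ) : D0 (fun z : Fin (m+1) → ℝ => z 0) x = 1 := by
  simp only [D0, pd]
  have := (ContinuousLinearMap.proj (R := ℝ) (φ := fun _ : Fin (m+1) => ℝ) 0).hasFDerivAt (x := x)
  rw [HasFDerivAt.fderiv (f := fun z : Fin (m+1) → ℝ => z 0) this]; simp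

lemma tl_single : tl (Pi.single (0 : Fin (m+1)) (1:ℝ)) = 0 := by
  ext i; simp [tl]

/-- tail as clm -/
noncomputable def tlL : (Fin (m+1) → ℝ) →L[ℝ] (Fin m → ℝ) :=
  ContinuousLinearMap.pi fun i => ContinuousLinearMap.proj i.succ

lemma tlL_apply (x : Fin (m+1) → ℝ) : tlL x = tl x := rfl

lemma D0_tl {c : (Fin m → ℝ) → ℝ} (hc : AnalyticAt ℝ c 0) :
    ∀ᶠ z : Fin (m+1) → ℝ in 𝓝 0, D0 (fun z => c (tl z)) z = 0 := by
  filter_upwards [tl_tendsto'.eventually hc.eventually_analyticAt] with z hz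
  have h1 : HasFDerivAt (fun z => c (tl z)) ((fderiv ℝ c (tl z)).comp tlL) z :=
    HasFDerivAt.comp z (g := c) (f := tl) hz.differentiableAt.hasFDerivAt (tlL (m := m)).hasFDerivAt
  simp only [D0, pd]
  rw [h1.fderiv]
  simp [tlL_apply, tl_single]

lemma x0_an (x : Fin (m+1) → ℝ) : AnalyticAt ℝ (fun z : Fin (m+1) → ℝ => z 0) x := coord_analytic 0 x

lemma tlc_an {c : (Fin m → ℝ) → ℝ} (hc : AnalyticAt ℝ c 0) : AnalyticAt ℝ (fun z : Fin (m+1) → ℝ => c (tl z)) 0 :=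
  AnalyticAt.comp' (g := c) (by simpa using hc) (tl_analytic analyticAt_id)

lemma D0_smul (r : ℝ) {P : (Fin (m+1) → ℝ) → ℝ} {x} (hP : AnalyticAt ℝ P x) :
    ∀ᶠ z in 𝓝 x, D0 (fun z => r * P z) z = r * D0 P z := by
  filter_upwards [hP.eventually_analyticAt] with z h1
  simp only [D0, pd]
  rw [fderiv_const_mul h1.differentiableAt]; rfl

lemma D0_rec {Q ψ : (Fin (m+1) → ℝ) → ℝ} {c : (Fin m → ℝ) → ℝ} (hc : AnalyticAt ℝ c 0) (hψ : AnalyticAt ℝ ψ 0)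
    (h : ∀ᶠ z in 𝓝 0, Q z = c (tl z) + z 0 * ψ z) (k : ℕ) :
    ∀ᶠ z in 𝓝 0, (D0^[k+1] Q) z = z 0 * (D0^[k+1] ψ) z + (k+1) * (D0^[k] ψ) z := by
  induction k with
  | zero =>
    have h1 := D0_congr h
    filter_upwards [h1, D0_add (tlc_an hc) ((x0_an 0).mul hψ), D0_tl hc, D0_mul (x0_an 0) hψ] with z a b c d
    simp only [zero_add, Function.iterate_one, Function.iterate_zero, id]
    rw [a]
    refine b.trans ?_
    rw [c]
    refine (congrArg _ d).trans ?_
    rw [D0_coord]; simp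
  | succ k ih =>
    have h1 := D0_congr ih
    have a1 := D0_it_an hψ (k+1)
    have a0 := D0_it_an hψ k
    filter_upwards [h1, D0_add ((x0_an 0).mul a1) (analyticAt_const (v := ((k:ℝ)+1)) |>.mul a0), D0_smul ((k:ℝ)+1) a0, D0_mul (x0_an 0) a1] with z a b c d
    rw [Function.iterate_succ_apply', a]
    refine b.trans ?_
    refine (congrArg₂ (· + ·) d c).trans ?_
    beta_reduce
    rw [D0_coord, ← Function.iterate_succ_apply' D0, ← Function.iterate_succ_apply' D0]
    push_cast; ring

lemma cn0_an {g : (Fin (m+1) → ℝ) → ℝ} (hg : AnalyticAt ℝ g 0) : AnalyticAt ℝ (fun x : Fin m → ℝ => g (cn 0 x)) 0 :=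
  AnalyticAt.comp' (g := g) (f := fun x : Fin m → ℝ => cn 0 x) (by rwa [cn_zero_zero]) (cn_analytic analyticAt_const analyticAt_id)

lemma cn0_ev {p : (Fin (m+1) → ℝ) → Prop} (h : ∀ᶠ z in 𝓝 0, p z) : ∀ᶠ x : Fin m → ℝ in 𝓝 0, p (cn 0 x) :=
  (cn_tendsto tendsto_const_nhds tendsto_id).eventually h

lemma REP (d : ℕ) : ∀ {Q : (Fin (m+1) → ℝ) → ℝ}, AnalyticAt ℝ Q 0 →
    ∃ (c : ℕ → (Fin m → ℝ) → ℝ) (u : (Fin (m+1) → ℝ) → ℝ), (∀ k, AnalyticAt ℝ (c k) 0) ∧ AnalyticAt ℝ u 0 ∧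
      (∀ᶠ z in 𝓝 0, Q z = ∑ k ∈ Finset.range d, c k (tl z) * z 0 ^ k + z 0 ^ d * u z) ∧
      (∀ k < d, ∀ᶠ x in 𝓝 0, c k x = (D0^[k] Q) (cn 0 x) / k.factorial) ∧
      u 0 = (D0^[d] Q) 0 / d.factorial := by
  induction d with
  | zero =>
    intro Q hQ
    exact ⟨fun _ _ => 0, Q, fun _ => analyticAt_const, hQ, by simp, by simp, by simp⟩
  | succ d ih =>
    intro Q hQ
    obtain ⟨ψ, hψ, he⟩ := coord_div (0 : Fin (m+1)) hQ
    have hP : ∀ z : Fin (m+1) → ℝ, PP 0 z = cn 0 (tl z) := by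
      intro z; ext i
      refine Fin.cases (by simp [PP_apply]) (fun j => ?_) i
      simp [PP_apply, tl]
    have he' : ∀ᶠ z in 𝓝 0, Q z = Q (cn 0 (tl z)) + z 0 * ψ z := by
      filter_upwards [he] with z hz; rw [← hz, hP]; ring
    obtain ⟨c, u, hc, hu, h1, h2, h3⟩ := ih hψ
    have hrec := D0_rec (cn0_an hQ) hψ he'
    refine ⟨fun k => Nat.casesOn k (fun x => Q (cn 0 x)) c, u, ?_, hu, ?_, ?_, ?_⟩
    · rintro (_ | k)
      · exact cn0_an hQ
      · exact hc k
    · filter_upwards [he', h1] with z a b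
      rw [a, b, Finset.sum_range_succ']
      show _ = ∑ k ∈ Finset.range d, c k (tl z) * z 0 ^ (k+1) + Q (cn 0 (tl z)) * z 0 ^ 0 + _
      have : ∀ k ∈ Finset.range d, c k (tl z) * z 0 ^ (k+1) = z 0 * (c k (tl z) * z 0 ^ k) := fun k _ => by ring
      rw [mul_add, Finset.sum_congr rfl this, ← Finset.mul_sum]
      ring
    · rintro (_ | k) hk
      · simp
      · filter_upwards [h2 k (by omega), cn0_ev (hrec k)] with x a b
        show c k x = _
        rw [a, b, Nat.factorial_succ]
        have : ((k.factorial : ℕ) : ℝ) ≠ 0 := by positivity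
        push_cast
        simp only [cn_zero, zero_mul, zero_add]
        field_simp
    · have b := (hrec d).self_of_nhds
      rw [h3, b, Nat.factorial_succ]
      push_cast
      simp only [Pi.zero_apply, zero_mul, zero_add]
      field_simp

lemma cns_tendsto : Tendsto (fun s : ℝ => cn s (0 : Fin m → ℝ)) (𝓝 0) (𝓝 0) :=
  cn_tendsto tendsto_id tendsto_const_nhds

/-- if all derivatives of order < d vanish then Q on the line is divisible by s^d -/
lemma line_div {Q : (Fin (m+1) → ℝ) → ℝ} (hQ : AnalyticAt ℝ Q 0) (d : ℕ) (h : ∀ k < d, (D0^[k] Q) 0 = 0) :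
    ∃ w : ℝ → ℝ, ContinuousAt w 0 ∧ ∀ᶠ s in 𝓝 0, Q (cn s 0) = s ^ d * w s := by
  obtain ⟨c, u, hc, hu, h1, h2, h3⟩ := REP d hQ
  refine ⟨fun s => u (cn s 0), ?_, ?_⟩
  · have : ContinuousAt u (cn 0 0) := by rw [cn_zero_zero]; exact hu.continuousAt
    refine ContinuousAt.comp (f := fun s : ℝ => cn s (0 : Fin m → ℝ)) this ?_
    have := cns_tendsto (m := m)
    rwa [ContinuousAt, cn_zero_zero]
  · filter_upwards [cns_tendsto.eventually h1] with s hs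
    rw [hs, Finset.sum_eq_zero]
    · simp
    · intro k hk
      have := (h2 k (Finset.mem_range.1 hk)).self_of_nhds
      rw [tl_cn, this, cn_zero_zero, h k (Finset.mem_range.1 hk)]; simp

lemma ord_exists {Q : (Fin (m+1) → ℝ) → ℝ} (hQ : AnalyticAt ℝ Q 0) (h : ¬ ∀ᶠ s in 𝓝 0, Q (cn s 0) = 0) :
    ∃ k, (D0^[k] Q) 0 ≠ 0 := by
  by_contra! hk
  have ha : AnalyticAt ℝ (fun s : ℝ => Q (cn s 0)) 0 :=
    AnalyticAt.comp' (g := Q) (f := fun s : ℝ => cn s (0 : Fin m → ℝ)) (by rwa [cn_zero_zero]) (cn_analytic analyticAt_id analyticAt_const)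
  obtain ⟨d, v, hv, hv0, hve⟩ := (ha.exists_eventuallyEq_pow_smul_nonzero_iff).2 h
  obtain ⟨w, hw, hwe⟩ := line_div hQ (d+1) (fun k _ => hk k)
  have e1 : ∀ᶠ s in 𝓝[≠] (0:ℝ), v s = s * w s := by
    filter_upwards [hve.filter_mono nhdsWithin_le_nhds, hwe.filter_mono nhdsWithin_le_nhds, self_mem_nhdsWithin] with s a b c
    rw [a, sub_zero, smul_eq_mul, pow_succ, mul_assoc] at b
    exact mul_left_cancel₀ (pow_ne_zero _ c) b
  have t1 : Tendsto v (𝓝[≠] 0) (𝓝 (v 0)) := hv.continuousAt.tendsto.mono_left nhdsWithin_le_nhds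
  have t2 : Tendsto (fun s => s * w s) (𝓝[≠] 0) (𝓝 (0 * w 0)) :=
    (tendsto_id.mul hw.tendsto).mono_left nhdsWithin_le_nhds
  have := tendsto_nhds_unique (t1.congr' e1) t2
  exact hv0 (by simpa using this)

lemma poly_dvd (d : ℕ) : ∀ (p : Polynomial ℝ) (w : ℝ → ℝ), ContinuousAt w 0 → (∀ᶠ s in 𝓝[≠] (0:ℝ), p.eval s = s ^ d * w s) →
    Polynomial.X ^ d ∣ p := by
  induction d with
  | zero => intro p w _ _; simp
  | succ d ih =>
    intro p w hw h
    have t1 : Tendsto (fun s => p.eval s) (𝓝[≠] 0) (𝓝 (p.eval 0)) := p.continuous.continuousAt.tendsto.mono_left nhdsWithin_le_nhds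
    have t2 : Tendsto (fun s => s ^ (d+1) * w s) (𝓝[≠] 0) (𝓝 (0 ^ (d+1) * w 0)) :=
      (((continuous_pow (d+1)).tendsto 0).mul hw.tendsto).mono_left nhdsWithin_le_nhds
    have e := tendsto_nhds_unique (t1.congr' h) t2
    have : Polynomial.X ∣ p := by
      rw [Polynomial.X_dvd_iff, Polynomial.coeff_zero_eq_eval_zero, e]; simp
    obtain ⟨q, rfl⟩ := this
    rw [pow_succ']
    refine mul_dvd_mul_left _ (ih q w hw ?_)
    filter_upwards [h, self_mem_nhdsWithin] with s a c
    simp only [Polynomial.eval_mul, Polynomial.eval_X, pow_succ', mul_assoc] at a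
    exact mul_left_cancel₀ c a
end DD
end HLD

namespace HLD
open Set Filter Topology QDC
open scoped ContDiff

section Sh
variable {m : ℕ}

/-- cons as clm -/
noncomputable def cnL : ((Fin m → ℝ) × ℝ) →L[ℝ] (Fin (m+1) → ℝ) :=
  LinearMap.toContinuousLinearMap
    { toFun := fun p => cn p.2 p.1
      map_add' := by
        intro p q; ext i
        refine Fin.cases (by simp) (fun j => by simp) i
      map_smul' := by
        intro r q; ext i
        refine Fin.cases (by simp) (fun j => by simp) i }

lemma cnL_apply (p : (Fin m → ℝ) × ℝ) : cnL p = cn p.2 p.1 := rfl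

lemma cnL_single (s : ℝ) : cnL ((0 : Fin m → ℝ), s) = s • Pi.single 0 1 := by
  ext i
  refine Fin.cases (by simp [cnL_apply]) (fun j => by simp [cnL_apply]) i

lemma ift {R : (Fin (m+1) → ℝ) → ℝ} (hR : AnalyticAt ℝ R 0) (h0 : R 0 = 0) (h1 : D0 R 0 ≠ 0) :
    ∃ τ : (Fin m → ℝ) → ℝ, AnalyticAt ℝ τ 0 ∧ τ 0 = 0 ∧ ∀ᶠ x in 𝓝 0, R (cn (τ x) x) = 0 := by
  let f : ((Fin m → ℝ) × ℝ) → ℝ := fun p => R (cnL p)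
  have e0 : cnL (0 : (Fin m → ℝ) × ℝ) = 0 := map_zero _
  have hf : AnalyticAt ℝ f 0 := AnalyticAt.comp' (g := R) (f := cnL) (by rwa [e0]) (cnL.analyticAt _)
  have hfd : HasFDerivAt f ((fderiv ℝ R 0).comp cnL) 0 := by
    have : HasFDerivAt R (fderiv ℝ R 0) (cnL (0 : (Fin m → ℝ) × ℝ)) := by
      rw [e0]; exact hR.differentiableAt.hasFDerivAt
    exact this.comp 0 cnL.hasFDerivAt
  have cdf : ContDiffAt ℝ ω f 0 := hf.contDiffAt
  have if₂ : (fderiv ℝ f 0 ∘L .inr ℝ (Fin m → ℝ) ℝ).IsInvertible := by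
    refine ⟨ContinuousLinearEquiv.unitsEquivAut ℝ (Units.mk0 _ h1), ?_⟩
    ext
    rw [hfd.fderiv]
    simp [cnL_single, D0, pd]
  refine ⟨cdf.implicitFunction (by simp) if₂, ?_, ?_, ?_⟩
  · exact (cdf.contDiffAt_implicitFunction (by simp) if₂).analyticAt
  · exact cdf.implicitFunction_apply_self (by simp) if₂
  · have := cdf.eventually_apply_implicitFunction (by simp) if₂
    filter_upwards [this] with x hx
    have e : f 0 = 0 := by show R (cnL 0) = 0; rw [e0, h0]
    rw [e] at hx
    exact hx

/-- the shift -/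
def sh (τ : (Fin m → ℝ) → ℝ) (x : Fin (m+1) → ℝ) : Fin (m+1) → ℝ := cn (x 0 + τ (tl x)) (tl x)

lemma sh_an {τ : (Fin m → ℝ) → ℝ} (h : AnalyticAt ℝ τ 0) : AnalyticAt ℝ (sh τ) 0 :=
  cn_analytic ((x0_an 0).add (tlc_an h)) (tl_analytic analyticAt_id)

lemma sh_zero {τ : (Fin m → ℝ) → ℝ} (h : τ 0 = 0) : sh τ 0 = 0 := by
  have : tl (0 : Fin (m+1) → ℝ) = 0 := rfl
  simp [sh, this, h]

lemma sh_line {τ : (Fin m → ℝ) → ℝ} (x : Fin (m+1) → ℝ) (s : ℝ) :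
    sh τ (x + s • Pi.single 0 1) = sh τ x + s • Pi.single 0 1 := by
  have : tl (x + s • Pi.single (0 : Fin (m+1)) (1:ℝ)) = tl x := by
    ext i; simp [tl]
  ext i
  simp only [sh, this]
  refine Fin.cases ?_ (fun j => ?_) i
  · simp; ring
  · simp

lemma D0_sh {τ : (Fin m → ℝ) → ℝ} (h : AnalyticAt ℝ τ 0) (h0 : τ 0 = 0) {P : (Fin (m+1) → ℝ) → ℝ} (hP : AnalyticAt ℝ P 0) :
    ∀ᶠ z in 𝓝 0, D0 (fun z => P (sh τ z)) z = D0 P (sh τ z) := by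
  have a := an_comp (sh_an h) (sh_zero h0) hP
  filter_upwards [a.eventually_analyticAt, ev_comp (sh_an h) (sh_zero h0) hP.eventually_analyticAt] with z h1 h2
  have l : ∀ w : Fin (m+1) → ℝ, HasDerivAt (fun s : ℝ => w + s • Pi.single (0 : Fin (m+1)) (1:ℝ)) (Pi.single 0 1) 0 := by
    intro w
    have := (((hasDerivAt_id (0:ℝ)).smul_const (Pi.single (0 : Fin (m+1)) (1:ℝ))).const_add w)
    simpa using this
  have d1 : HasDerivAt (fun s : ℝ => P (sh τ (z + s • Pi.single (0 : Fin (m+1)) (1:ℝ)))) (D0 (fun z => P (sh τ z)) z) 0 := by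
    have k : HasFDerivAt (fun z => P (sh τ z)) (fderiv ℝ (fun z => P (sh τ z)) z) (z + (0:ℝ) • Pi.single (0 : Fin (m+1)) (1:ℝ)) := by
      rw [zero_smul, add_zero]; exact h1.differentiableAt.hasFDerivAt
    exact HasFDerivAt.comp_hasDerivAt (l := fun z => P (sh τ z)) (f := fun s : ℝ => z + s • Pi.single (0 : Fin (m+1)) (1:ℝ)) 0 k (l z)
  have d2 : HasDerivAt (fun s : ℝ => P (sh τ z + s • Pi.single (0 : Fin (m+1)) (1:ℝ))) (D0 P (sh τ z)) 0 := by
    have k : HasFDerivAt P (fderiv ℝ P (sh τ z)) (sh τ z + (0:ℝ) • Pi.single (0 : Fin (m+1)) (1:ℝ)) := by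
      rw [zero_smul, add_zero]; exact h2.differentiableAt.hasFDerivAt
    exact k.comp_hasDerivAt 0 (l (sh τ z))
  simp only [sh_line] at d1
  exact d1.unique d2

lemma D0_it_sh {τ : (Fin m → ℝ) → ℝ} (h : AnalyticAt ℝ τ 0) (h0 : τ 0 = 0) {P : (Fin (m+1) → ℝ) → ℝ} (hP : AnalyticAt ℝ P 0) (k : ℕ) :
    ∀ᶠ z in 𝓝 0, (D0^[k] (fun z => P (sh τ z))) z = (D0^[k] P) (sh τ z) := by
  induction k with
  | zero => simp
  | succ k ih =>
    filter_upwards [D0_congr ih, D0_sh h h0 (D0_it_an hP k)] with z a b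
    rw [Function.iterate_succ_apply', a, b, Function.iterate_succ_apply']

/-- Tschirnhausen normal form -/
lemma tsch {Q : (Fin (m+1) → ℝ) → ℝ} (hQ : AnalyticAt ℝ Q 0) (e : ℕ) (h0 : ∀ k < e+1, (D0^[k] Q) 0 = 0)
    (h1 : (D0^[e+1] Q) 0 ≠ 0) :
    ∃ τ : (Fin m → ℝ) → ℝ, AnalyticAt ℝ τ 0 ∧ τ 0 = 0 ∧
    ∃ (c : ℕ → (Fin m → ℝ) → ℝ) (u : (Fin (m+1) → ℝ) → ℝ), (∀ k, AnalyticAt ℝ (c k) 0) ∧ AnalyticAt ℝ u 0 ∧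
      (∀ᶠ z in 𝓝 0, Q (sh τ z) = ∑ k ∈ Finset.range (e+1), c k (tl z) * z 0 ^ k + z 0 ^ (e+1) * u z) ∧
      (∀ k < e+1, c k 0 = 0) ∧ (∀ᶠ x in 𝓝 0, c e x = 0) ∧ u 0 ≠ 0 := by
  obtain ⟨τ, t1, t2, t3⟩ := ift (D0_it_an hQ e) (h0 e (by omega)) (by rwa [Function.iterate_succ_apply'] at h1)
  obtain ⟨c, u, hc, hu, r1, r2, r3⟩ := REP (e+1) (an_comp (sh_an t1) (sh_zero t2) hQ)
  refine ⟨τ, t1, t2, c, u, hc, hu, r1, ?_, ?_, ?_⟩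
  · intro k hk
    rw [(r2 k hk).self_of_nhds, cn_zero_zero, (D0_it_sh t1 t2 hQ k).self_of_nhds, sh_zero t2, h0 k hk]; simp
  · filter_upwards [r2 e (by omega), cn0_ev (D0_it_sh t1 t2 hQ e), t3] with x a b c
    rw [a, b]
    simp [sh, c]
  · rw [r3, (D0_it_sh t1 t2 hQ _).self_of_nhds, sh_zero t2]
    have : (((e+1).factorial : ℕ) : ℝ) ≠ 0 := by positivity
    exact div_ne_zero h1 this
end Sh
end HLD

namespace HLD
open Set Filter Topology QDC
open scoped ContDiff

lemma poly_aux (e : ℕ) (c : ℕ → ℝ) (u T : ℝ) (hu : u ≠ 0) (hc : c e = 0)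
    (h : (Polynomial.X : Polynomial ℝ) ^ (e+1) ∣
      ∑ k ∈ Finset.range (e+1), Polynomial.C (c k) * (Polynomial.X + Polynomial.C T) ^ k + Polynomial.C u * (Polynomial.X + Polynomial.C T) ^ (e+1)) :
    ∀ k < e+1, c k = 0 := by
  obtain ⟨q, hq⟩ := h
  set p : Polynomial ℝ := ∑ k ∈ Finset.range (e+1), Polynomial.C (c k) * Polynomial.X ^ k + Polynomial.C u * Polynomial.X ^ (e+1) with hp
  have h1 : p = (Polynomial.X + Polynomial.C (-T)) ^ (e+1) * q.comp (Polynomial.X + Polynomial.C (-T)) := by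
    have := congrArg (fun r => Polynomial.comp r (Polynomial.X + Polynomial.C (-T))) hq
    simp only [Polynomial.add_comp, Polynomial.mul_comp, Polynomial.pow_comp, Polynomial.X_comp, Polynomial.C_comp,
      Polynomial.sum_comp] at this
    rw [← this]
    have e : (Polynomial.X + Polynomial.C (-T) + Polynomial.C T : Polynomial ℝ) = Polynomial.X := by simp
    rw [e]
  have hcoeff : ∀ k < e + 1, p.coeff k = c k := by
    intro k hk
    simp only [hp, Polynomial.coeff_add, Polynomial.finset_sum_coeff, Polynomial.coeff_C_mul_X_pow]
    rw [if_neg (by omega), add_zero, Finset.sum_eq_single k]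
    · simp
    · intro j _ hj; rw [if_neg (Ne.symm hj)]
    · intro hk'; exact absurd (Finset.mem_range.2 hk) hk'
  have hcd : p.coeff (e+1) = u := by
    simp only [hp, Polynomial.coeff_add, Polynomial.finset_sum_coeff, Polynomial.coeff_C_mul_X_pow]
    rw [Finset.sum_eq_zero]
    · simp
    · intro k hk; rw [if_neg]; have := Finset.mem_range.1 hk; omega
  have hdeg : p.natDegree ≤ e + 1 := by
    rw [Polynomial.natDegree_le_iff_coeff_eq_zero]
    intro N hN
    simp only [hp, Polynomial.coeff_add, Polynomial.finset_sum_coeff, Polynomial.coeff_C_mul_X_pow]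
    rw [Finset.sum_eq_zero, if_neg (by omega), add_zero]
    intro k hk; rw [if_neg]; have := Finset.mem_range.1 hk; omega
  set r := q.comp (Polynomial.X + Polynomial.C (-T)) with hr
  have hmon : ((Polynomial.X + Polynomial.C (-T) : Polynomial ℝ) ^ (e+1)).Monic := (Polynomial.monic_X_add_C _).pow _
  have hr0 : r ≠ 0 := by
    intro h0; rw [h1, h0, mul_zero] at hcd; exact hu (by simpa using hcd.symm)
  have hrd : r.natDegree = 0 := by
    have := hmon.natDegree_mul' hr0
    rw [← h1, (Polynomial.monic_X_add_C (-T)).natDegree_pow, Polynomial.natDegree_X_add_C] at this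
    omega
  obtain ⟨v, hv⟩ : ∃ v, r = Polynomial.C v := ⟨_, Polynomial.eq_C_of_natDegree_eq_zero hrd⟩
  have hco : ∀ k, p.coeff k = (-T) ^ (e+1-k) * ((e+1).choose k : ℝ) * v := by
    intro k
    rw [h1, hv, Polynomial.coeff_mul_C, Polynomial.coeff_X_add_C_pow]
  have hvu : v = u := by rw [← hcd, hco]; simp
  have hT : T = 0 := by
    have := hco e
    rw [hcoeff e (by omega), hc, hvu] at this
    have h2 : e + 1 - e = 1 := by omega
    rw [h2, pow_one, Nat.choose_succ_self_right] at this
    have h3 : ((e+1 : ℕ) : ℝ) ≠ 0 := by positivity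
    have h4 := (mul_eq_zero.1 this.symm).resolve_right hu
    have h5 := (mul_eq_zero.1 h4).resolve_right h3
    linarith
  intro k hk
  rw [← hcoeff k hk, hco, hT, neg_zero, zero_pow (by omega)]; simp

section Fin
variable {I : Type*} (U : Ultrafilter I) {m : ℕ}

lemma finish (e : ℕ)
    (IH : ∀ (h : (Fin m → ℝ) → ℝ) (Q : (Fin (m+1) → ℝ) → ℝ), NZ h → AnalyticAt ℝ Q 0 → (∃ k < e+1, (D0^[k] Q) 0 ≠ 0) →
      ∀ X : I → (Fin (m+1) → ℝ), Tendsto X U (𝓝 0) → LU U (fun x => h (tl x) * Q x) X)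
    {h : (Fin m → ℝ) → ℝ} (hh : MU h) {γ : Fin m → ℕ} (hγ : γ ≠ 0) {c : ℕ → (Fin m → ℝ) → ℝ}
    (hc : ∀ k, AnalyticAt ℝ (c k) 0) {k0 : ℕ} (hk0 : k0 < e+1) (hck0 : c k0 0 ≠ 0) (hce : c e 0 = 0)
    {u : (Fin (m+1) → ℝ) → ℝ} (hu : AnalyticAt ℝ u 0) (hu0 : u 0 ≠ 0) {F : (Fin (m+1) → ℝ) → ℝ}
    (hF : ∀ᶠ x in 𝓝 0, F x = h (tl x) * (∑ k ∈ Finset.range (e+1), mono (tl x) ((e+1-k) • γ) * c k (tl x) * x 0 ^ k + x 0 ^ (e+1) * u x))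
    {X : I → (Fin (m+1) → ℝ)} (hX : Tendsto X U (𝓝 0)) : LU U F X := by
  have tl0 : tl (0 : Fin (m+1) → ℝ) = 0 := rfl
  obtain ⟨δ, hδ, hδ'⟩ : ∃ δ > 0, ∀ ρ : ℝ, |ρ| ≤ δ → u 0 + ∑ k ∈ Finset.range (e+1), c k 0 * ρ ^ (e+1-k) ≠ 0 := by
    have hcont : Continuous (fun ρ : ℝ => u 0 + ∑ k ∈ Finset.range (e+1), c k 0 * ρ ^ (e+1-k)) := by fun_prop
    have h0 : u 0 + ∑ k ∈ Finset.range (e+1), c k 0 * (0:ℝ) ^ (e+1-k) ≠ 0 := by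
      rw [Finset.sum_eq_zero, add_zero]; exact hu0
      intro k hk
      have := Finset.mem_range.1 hk
      rw [zero_pow (by omega), mul_zero]
    obtain ⟨ε, hε, hb⟩ := Metric.eventually_nhds_iff.1 (hcont.continuousAt.eventually_ne h0)
    refine ⟨ε/2, by positivity, fun ρ hρ => hb ?_⟩
    rw [Real.dist_eq, sub_zero]; linarith
  by_cases hcase : ∀ᶠ i in (U : Filter I), |mono (tl (X i)) γ| < δ * |X i 0|
  · -- Case B
    have hcond : ∀ᶠ i in (U : Filter I), δ⁻¹ * |mono (tl (X i)) γ| < |X i 0| := by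
      filter_upwards [hcase] with i hi
      rw [inv_mul_lt_iff₀ hδ]; exact hi
    obtain ⟨π, hπ, hπ0, Y, hY, hYX, hMU, ρ, hρ, hρe⟩ := toric γ (inv_pos.2 hδ) hX hcond
    have hρ0 : |ρ 0| ≤ δ := by
      have t : Tendsto (fun i => |ρ (Y i)|) U (𝓝 |ρ 0|) := (hρ.continuousAt.tendsto.comp hY).abs
      refine le_of_tendsto t ?_
      filter_upwards [hY.eventually hρe, hYX, hcase] with i a b c
      rw [b] at a
      rw [a, abs_mul, mul_comm] at c
      have : 0 < |X i 0| := by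
        by_contra h0
        have : |X i 0| = 0 := le_antisymm (not_lt.1 h0) (abs_nonneg _)
        rw [this] at c; simp at c
      exact (lt_of_mul_lt_mul_right c this.le).le
    refine ⟨π, hπ, hπ0, Y, hY, hYX, ?_⟩
    have hπt : AnalyticAt ℝ (fun z => tl (π z)) 0 := tl_analytic hπ
    have hπt0 : tl (π 0) = 0 := by rw [hπ0]; rfl
    have M1 : MU (fun z => h (tl (π z))) := hh.comp hπt hπt0 (fun i => hMU i.succ)
    have hV : AnalyticAt ℝ (fun z => u (π z) + ∑ k ∈ Finset.range (e+1), c k (tl (π z)) * ρ z ^ (e+1-k)) 0 := by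
      refine (an_comp hπ hπ0 hu).add ?_
      apply Finset.analyticAt_fun_sum
      intro k _
      exact (an_comp hπt hπt0 (hc k)).mul (hρ.pow _)
    have M2 := MU.unit hV (by beta_reduce; rw [hπ0, tl0]; exact hδ' _ hρ0)
    refine (M1.mul (((hMU 0).pow (e+1)).mul M2)).congr ?_
    filter_upwards [ev_comp hπ hπ0 hF, hρe] with z a b
    rw [a]
    congr 1
    rw [mul_add, Finset.mul_sum, add_comm]
    congr 1
    refine Finset.sum_congr rfl fun k hk => ?_
    have := Finset.mem_range.1 hk
    rw [mono_smul, b, mul_pow]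
    have e2 : π z 0 ^ (e+1) = π z 0 ^ (e+1-k) * π z 0 ^ k := by rw [← pow_add]; congr 1; omega
    rw [e2]; ring
  · -- Case A
    rw [← Ultrafilter.eventually_not] at hcase
    have hb : ∀ᶠ i in (U : Filter I), |X i 0 / mono (tl (X i)) γ| ≤ δ⁻¹ := by
      filter_upwards [hcase] with i hi
      rw [not_lt] at hi
      by_cases hm : mono (tl (X i)) γ = 0
      · rw [hm, div_zero, abs_zero]; positivity
      · rw [abs_div, div_le_iff₀ (abs_pos.2 hm), ← div_eq_inv_mul, le_div_iff₀ hδ, mul_comm]; exact hi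
    obtain ⟨T, hT⟩ := ultra_lim hb
    set π : (Fin (m+1) → ℝ) → (Fin (m+1) → ℝ) := fun z => cn (mono (tl z) γ * (T + z 0)) (tl z) with hπd
    have hπ : AnalyticAt ℝ π 0 :=
      cn_analytic ((tlc_an (mono_analytic γ 0)).mul (analyticAt_const.add (x0_an 0))) (tl_analytic analyticAt_id)
    have hπc : ∀ s, π (cn s 0) = 0 := by
      intro s
      simp only [hπd, tl_cn, cn_zero, mono_at_zero hγ, zero_mul, cn_zero_zero]
    have hπ0 : π 0 = 0 := by have := hπc 0; rwa [cn_zero_zero] at this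
    set Y : I → (Fin (m+1) → ℝ) := fun i => cn (X i 0 / mono (tl (X i)) γ - T) (tl (X i)) with hYd
    have hY : Tendsto Y U (𝓝 0) := cn_tendsto (by simpa using hT.sub_const T) (tl_tendsto hX)
    have hYX : ∀ᶠ i in (U : Filter I), π (Y i) = X i := by
      filter_upwards [hcase] with i hi
      rw [not_lt] at hi
      simp only [hπd, hYd, tl_cn, cn_zero, add_sub_cancel]
      by_cases hm : mono (tl (X i)) γ = 0
      · rw [hm, abs_zero] at hi
        have : X i 0 = 0 := by
          rw [← abs_eq_zero]
          exact le_antisymm (nonpos_of_mul_nonpos_right hi hδ) (abs_nonneg _)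
        rw [hm, zero_mul]
        nth_rewrite 1 [← this]
        exact cn_tl _
      · rw [mul_div_cancel₀ _ hm]; exact cn_tl _
    refine LU.trans hπ hπ0 hYX ?_
    set Q : (Fin (m+1) → ℝ) → ℝ := fun z => ∑ k ∈ Finset.range (e+1), c k (tl z) * (T + z 0) ^ k + (T + z 0) ^ (e+1) * u (π z) with hQd
    have hTz : AnalyticAt ℝ (fun z : Fin (m+1) → ℝ => T + z 0) 0 := analyticAt_const.add (x0_an 0)
    have hQ : AnalyticAt ℝ Q 0 := by
      refine AnalyticAt.add ?_ ((hTz.pow _).mul (an_comp hπ hπ0 hu))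
      apply Finset.analyticAt_fun_sum
      intro k _
      exact (tlc_an (hc k)).mul (hTz.pow _)
    have hord : ∃ k < e+1, (D0^[k] Q) 0 ≠ 0 := by
      by_contra! hno
      obtain ⟨w, hw, hwe⟩ := line_div hQ (e+1) hno
      have := poly_dvd (e+1) (∑ k ∈ Finset.range (e+1), Polynomial.C (c k 0) * (Polynomial.X + Polynomial.C T) ^ k + Polynomial.C (u 0) * (Polynomial.X + Polynomial.C T) ^ (e+1)) w hw (by
        filter_upwards [hwe.filter_mono nhdsWithin_le_nhds] with s hs
        rw [← hs]
        simp only [hQd, hπc, tl_cn, cn_zero, Polynomial.eval_add, Polynomial.eval_finset_sum, Polynomial.eval_mul, Polynomial.eval_C, Polynomial.eval_pow, Polynomial.eval_X]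
        rw [add_comm s T, mul_comm (u 0)])
      exact hck0 (poly_aux e (fun k => c k 0) (u 0) T hu0 hce this k0 hk0)
    have hNZ : NZ (fun x : Fin m → ℝ => h x * mono x ((e+1) • γ)) :=
      MU.nz (hh.mul ⟨_, fun _ => 1, analyticAt_const, one_ne_zero, Eventually.of_forall fun z => (one_mul _).symm⟩)
    refine (IH _ Q hNZ hQ hord Y hY).congr ?_
    filter_upwards [ev_comp hπ hπ0 hF] with z a
    rw [a]
    simp only [hQd, hπd, tl_cn, cn_zero]
    rw [mul_assoc]
    congr 1
    rw [mul_add (mono (tl z) ((e+1) • γ)), Finset.mul_sum]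
    congr 1
    · refine Finset.sum_congr rfl fun k hk => ?_
      have := Finset.mem_range.1 hk
      have e2 : mono (tl z) ((e+1) • γ) = mono (tl z) γ ^ (e+1-k) * mono (tl z) γ ^ k := by
        rw [mono_smul, ← pow_add]; congr 1; omega
      rw [e2, mono_smul, mul_pow]; ring
    · rw [mono_smul, mul_pow, mul_assoc]
end Fin
end HLD

namespace HLD
open Set Filter Topology QDC
open scoped ContDiff

section Pst
variable {I : Type*} {U : Ultrafilter I} {m : ℕ}

lemma powsub {M : ℕ} (hM : 0 < M) {X : I → (Fin m → ℝ)} (hX : Tendsto X U (𝓝 0)) :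
    ∃ ε : Fin m → ℝ, (∀ j, ε j ≠ 0) ∧ ∃ Y : I → (Fin m → ℝ), Tendsto Y U (𝓝 0) ∧
      ∀ᶠ i in (U : Filter I), (fun j => ε j * Y i j ^ M) = X i := by
  have h1 : ∀ j, ∃ ε : ℝ, ε ≠ 0 ∧ ∀ᶠ i in (U : Filter I), ε * |X i j| = X i j := by
    intro j
    have : ∀ᶠ i in (U : Filter I), 0 ≤ X i j ∨ X i j ≤ 0 := Eventually.of_forall fun i => le_total _ _
    rcases Ultrafilter.eventually_or.1 this with h | h
    · exact ⟨1, one_ne_zero, h.mono fun i hi => by rw [one_mul, abs_of_nonneg hi]⟩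
    · exact ⟨-1, by norm_num, h.mono fun i hi => by rw [abs_of_nonpos hi]; ring⟩
  choose ε hε hε' using h1
  refine ⟨ε, hε, fun i j => |X i j| ^ ((M:ℝ)⁻¹), ?_, ?_⟩
  · rw [tendsto_pi_nhds]
    intro j
    have t := (tendsto_pi_nhds.1 hX j).abs
    have hp : (0:ℝ) < (M:ℝ)⁻¹ := by positivity
    have := t.rpow_const (p := (M:ℝ)⁻¹) (Or.inr hp.le)
    simpa [Real.zero_rpow hp.ne'] using this
  · filter_upwards [eventually_all.2 hε'] with i hi
    ext j
    rw [Real.rpow_inv_natCast_pow (abs_nonneg _) hM.ne', hi j]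

lemma lift_an {π' : (Fin m → ℝ) → (Fin m → ℝ)} (h1 : AnalyticAt ℝ π' 0) :
    AnalyticAt ℝ (fun z : Fin (m+1) → ℝ => cn (z 0) (π' (tl z))) 0 :=
  cn_analytic (x0_an 0) (AnalyticAt.comp' (g := π') (by simpa using h1) (tl_analytic analyticAt_id))

lemma lift_zero {π' : (Fin m → ℝ) → (Fin m → ℝ)} (h2 : π' 0 = 0) :
    (fun z : Fin (m+1) → ℝ => cn (z 0) (π' (tl z))) 0 = 0 := by
  show cn 0 (π' 0) = 0
  rw [h2, cn_zero_zero]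

lemma LU.lift {F : (Fin (m+1) → ℝ) → ℝ} {X : I → (Fin (m+1) → ℝ)} {π' : (Fin m → ℝ) → (Fin m → ℝ)}
    (h1 : AnalyticAt ℝ π' 0) (h2 : π' 0 = 0) {Y : I → (Fin m → ℝ)} 
    (e : ∀ᶠ i in (U : Filter I), π' (Y i) = tl (X i))
    (h : LU U (fun z => F (cn (z 0) (π' (tl z)))) (fun i => cn (X i 0) (Y i))) : LU U F X := by
  refine LU.trans (lift_an h1) (lift_zero h2) (Y := fun i => cn (X i 0) (Y i)) ?_ h
  filter_upwards [e] with i hi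
  simp only [tl_cn, cn_zero, hi]
  exact cn_tl _

lemma mono_sub (ε z : Fin m → ℝ) (M : ℕ) (β : Fin m → ℕ) :
    mono (fun j => ε j * z j ^ M) β = mono ε β * mono z (M • β) := by
  simp only [mono, mul_pow, Finset.prod_mul_distrib, Pi.smul_apply, smul_eq_mul, pow_mul]

lemma step3 (e : ℕ)
    (IH : ∀ (h : (Fin m → ℝ) → ℝ) (Q : (Fin (m+1) → ℝ) → ℝ), NZ h → AnalyticAt ℝ Q 0 → (∃ k < e+1, (D0^[k] Q) 0 ≠ 0) →
      ∀ X : I → (Fin (m+1) → ℝ), Tendsto X U (𝓝 0) → LU U (fun x => h (tl x) * Q x) X)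
    {h : (Fin m → ℝ) → ℝ} (hh : MU h) {c : ℕ → (Fin m → ℝ) → ℝ}
    (hc : ∀ k, AnalyticAt ℝ (c k) 0) (hc0 : ∀ k < e+1, c k 0 = 0) (hce : ∀ᶠ x in 𝓝 0, c e x = 0)
    (hcM : ∀ k < e+1, (∀ᶠ x in 𝓝 0, c k x = 0) ∨ MU (c k))
    (hdM : ∀ k < e+1, ∀ l < e+1, (∀ᶠ x in 𝓝 0, c k x ^ ((e+1).factorial / (e+1-k)) - c l x ^ ((e+1).factorial / (e+1-l)) = 0)
      ∨ MU (fun x => c k x ^ ((e+1).factorial / (e+1-k)) - c l x ^ ((e+1).factorial / (e+1-l))))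
    {u : (Fin (m+1) → ℝ) → ℝ} (hu : AnalyticAt ℝ u 0) (hu0 : u 0 ≠ 0) {F : (Fin (m+1) → ℝ) → ℝ}
    (hF : ∀ᶠ x in 𝓝 0, F x = h (tl x) * (∑ k ∈ Finset.range (e+1), c k (tl x) * x 0 ^ k + x 0 ^ (e+1) * u x))
    {X : I → (Fin (m+1) → ℝ)} (hX : Tendsto X U (𝓝 0)) : LU U F X := by
  classical
  set E : ℕ → ℕ := fun k => (e+1).factorial / (e+1-k) with hE
  have hE1 : ∀ k < e+1, (e+1-k) * E k = (e+1).factorial := fun k hk =>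
    Nat.mul_div_cancel' (Nat.dvd_factorial (by omega) (by omega))
  have hE0 : ∀ k < e+1, E k ≠ 0 := fun k hk h0 => by
    have := hE1 k hk
    rw [h0, mul_zero] at this
    exact (Nat.factorial_ne_zero _) this.symm
  set S := (Finset.range (e+1)).filter (fun k => ¬ ∀ᶠ x in 𝓝 0, c k x = 0) with hS
  have hSmem : ∀ k, k ∈ S ↔ k < e+1 ∧ ¬ ∀ᶠ x in 𝓝 0, c k x = 0 := by
    intro k; simp only [hS, Finset.mem_filter, Finset.mem_range]
  have hnS : ∀ k < e+1, k ∉ S → ∀ᶠ x in 𝓝 0, c k x = 0 := by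
    intro k hk hkS
    by_contra hcon
    exact hkS ((hSmem k).2 ⟨hk, hcon⟩)
  by_cases hne : S.Nonempty
  · have hMS : ∀ k, ∃ β v, k ∈ S → (AnalyticAt ℝ v 0 ∧ v 0 ≠ 0 ∧ ∀ᶠ z in 𝓝 0, c k z = v z * mono z β) := by
      intro k
      by_cases hk : k ∈ S
      · obtain ⟨β, v, hv⟩ := (hcM k ((hSmem k).1 hk).1).resolve_left ((hSmem k).1 hk).2
        exact ⟨β, v, fun _ => hv⟩
      · exact ⟨0, fun _ => 0, fun h => absurd h hk⟩
    choose β v hv using hMS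
    obtain ⟨k0, hk0, hmin⟩ := Finset.exists_minimalFor (fun k => E k • β k) S hne
    have hle : ∀ k ∈ S, E k0 • β k0 ≤ E k • β k := by
      intro k hk
      have hp : ∀ l ∈ S, ∀ᶠ z in 𝓝 0, c l z ^ E l = v l z ^ E l * mono z (E l • β l) := by
        intro l hl
        filter_upwards [(hv l hl).2.2] with z hz
        rw [hz, mul_pow, mono_smul]
      rcases compar ((hv k0 hk0).1.pow (E k0)) ((hv k hk).1.pow (E k)) (pow_ne_zero _ (hv k0 hk0).2.1)
        (pow_ne_zero _ (hv k hk).2.1) (hp k0 hk0) (hp k hk) (hdM k0 ((hSmem k0).1 hk0).1 k ((hSmem k).1 hk).1) with h | h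
      · exact h
      · exact hmin hk h
    have hk0' := ((hSmem k0).1 hk0).1
    set γ := E k0 • β k0 with hγd
    have hγ : γ ≠ 0 := by
      intro h0
      have hb : β k0 = 0 := by
        ext i
        have := congrFun h0 i
        simp only [hγd, Pi.smul_apply, smul_eq_mul, Pi.zero_apply] at this
        exact (Nat.mul_eq_zero.1 this).resolve_left (hE0 k0 hk0')
      have := (hv k0 hk0).2.2.self_of_nhds
      rw [hb, mono_zero, mul_one, hc0 k0 hk0'] at this
      exact (hv k0 hk0).2.1 this.symm
    obtain ⟨ε, hε, Y, hY, hYX⟩ := powsub (Nat.factorial_pos (e+1)) (tl_tendsto hX)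
    set M := (e+1).factorial with hMd
    set s : (Fin m → ℝ) → (Fin m → ℝ) := fun z j => ε j * z j ^ M with hs
    have hsa : AnalyticAt ℝ s 0 := analyticAt_pi' fun j => analyticAt_const.mul ((coord_analytic j 0).pow M)
    have hs0 : s 0 = 0 := by
      ext j
      show ε j * 0 ^ M = 0
      rw [zero_pow (Nat.factorial_ne_zero (e+1)), mul_zero]
    have hsM : ∀ j, MU (fun z => s z j) := fun j => (MU.unit analyticAt_const (hε j)).mul ((MU.coord j).pow M)
    refine LU.lift hsa hs0 hYX ?_
    set R : ℕ → (Fin m → ℕ) := fun k => (e+1-k) • (E k • β k - γ) with hR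
    have hsum : ∀ k ∈ S, M • β k = (e+1-k) • γ + R k := by
      intro k hk
      have h1 := hE1 k ((hSmem k).1 hk).1
      rw [← h1, mul_smul, hR]
      simp only []
      rw [← smul_add, add_tsub_cancel_of_le (hle k hk)]
    set c' : ℕ → (Fin m → ℝ) → ℝ := fun k z => if k ∈ S then v k (s z) * mono ε (β k) * mono z (R k) else 0 with hc'
    have hmε : ∀ k, mono ε (β k) ≠ 0 := fun k => mono_ne fun i _ => hε i
    refine finish U e IH (h := fun z => h (s z)) (hh.comp hsa hs0 hsM) hγ (c := c') ?_ hk0' ?_ ?_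
      (u := fun z => u (cn (z 0) (s (tl z)))) (an_comp (lift_an hsa) (lift_zero hs0) hu)
      ?_ ?_ (cn_tendsto (tendsto_pi_nhds.1 hX 0) hY)
    · intro k
      by_cases hk : k ∈ S
      · simp only [hc', if_pos hk]
        exact ((an_comp hsa hs0 (hv k hk).1).mul analyticAt_const).mul (mono_analytic _ _)
      · simp only [hc', if_neg hk]; exact analyticAt_const
    · simp only [hc', if_pos hk0]
      have : R k0 = 0 := by simp only [hR, hγd, tsub_self, smul_zero]
      rw [this, mono_zero, mul_one, hs0]
      exact mul_ne_zero (hv k0 hk0).2.1 (hmε k0)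
    · have : e ∉ S := fun h => ((hSmem e).1 h).2 hce
      simp only [hc', if_neg this]
    · have := lift_zero hs0
      beta_reduce at this ⊢
      rw [this]; exact hu0
    · have hall : ∀ᶠ x in 𝓝 (0 : Fin m → ℝ), ∀ k ∈ Finset.range (e+1), c k (s x) = mono x ((e+1-k) • γ) * c' k x := by
        rw [Filter.eventually_all_finset]
        intro k hk
        by_cases hkS : k ∈ S
        · filter_upwards [ev_comp hsa hs0 (hv k hkS).2.2] with x hx
          rw [hx]
          simp only [hc', if_pos hkS]
          simp only [hs]
          rw [mono_sub, hsum k hkS, mono_add]; ring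
        · filter_upwards [ev_comp hsa hs0 (hnS k (Finset.mem_range.1 hk) hkS)] with x hx
          rw [hx]
          simp only [hc', if_neg hkS, mul_zero]
      filter_upwards [ev_comp (lift_an hsa) (lift_zero hs0) hF, tl_tendsto'.eventually hall] with z a b
      rw [a]
      simp only [tl_cn, cn_zero]
      congr 2
      refine Finset.sum_congr rfl fun k hk => ?_
      rw [b k hk]
  · rw [Finset.not_nonempty_iff_eq_empty] at hne
    refine LU.of_MU (((MU.tl hh).mul (((MU.coord 0).pow (e+1)).mul (MU.unit hu hu0))).congr ?_) hX
    have hall : ∀ᶠ x in 𝓝 (0 : Fin m → ℝ), ∀ k ∈ Finset.range (e+1), c k x = 0 := by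
      rw [Filter.eventually_all_finset]
      intro k hk
      exact hnS k (Finset.mem_range.1 hk) (by simp [hne])
    filter_upwards [hF, tl_tendsto'.eventually hall] with z a b
    rw [a, Finset.sum_eq_zero, zero_add]
    intro k hk
    rw [b k hk, zero_mul]
end Pst
end HLD

namespace HLD
open Set Filter Topology QDC
open scoped ContDiff

section Qst
variable {I : Type*} {U : Ultrafilter I} {m : ℕ}

lemma NZ.one : NZ (fun _ : Fin m → ℝ => (1:ℝ)) := (MU.unit analyticAt_const one_ne_zero).nz

lemma step2 (e : ℕ)
    (LUm : ∀ G : (Fin m → ℝ) → ℝ, NZ G → ∀ X : I → (Fin m → ℝ), Tendsto X U (𝓝 0) → LU U G X)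
    (IH : ∀ (h : (Fin m → ℝ) → ℝ) (Q : (Fin (m+1) → ℝ) → ℝ), NZ h → AnalyticAt ℝ Q 0 → (∃ k < e+1, (D0^[k] Q) 0 ≠ 0) →
      ∀ X : I → (Fin (m+1) → ℝ), Tendsto X U (𝓝 0) → LU U (fun x => h (tl x) * Q x) X)
    {h : (Fin m → ℝ) → ℝ} (hh : NZ h) {c : ℕ → (Fin m → ℝ) → ℝ}
    (hc : ∀ k, AnalyticAt ℝ (c k) 0) (hc0 : ∀ k < e+1, c k 0 = 0) (hce : ∀ᶠ x in 𝓝 0, c e x = 0)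
    {u : (Fin (m+1) → ℝ) → ℝ} (hu : AnalyticAt ℝ u 0) (hu0 : u 0 ≠ 0) {F : (Fin (m+1) → ℝ) → ℝ}
    (hF : ∀ᶠ x in 𝓝 0, F x = h (tl x) * (∑ k ∈ Finset.range (e+1), c k (tl x) * x 0 ^ k + x 0 ^ (e+1) * u x))
    {X : I → (Fin (m+1) → ℝ)} (hX : Tendsto X U (𝓝 0)) : LU U F X := by
  classical
  set E : ℕ → ℕ := fun k => (e+1).factorial / (e+1-k) with hE
  -- normalised germs
  set nf : ((Fin m → ℝ) → ℝ) → ((Fin m → ℝ) → ℝ) := fun g => if (∀ᶠ x in 𝓝 0, g x = 0) then (fun _ => 1) else g with hnf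
  have nf_NZ : ∀ g, AnalyticAt ℝ g 0 → NZ (nf g) := by
    intro g hg
    by_cases h0 : ∀ᶠ x in 𝓝 0, g x = 0
    · simp only [hnf, if_pos h0]; exact NZ.one
    · simp only [hnf, if_neg h0]; exact ⟨hg, h0⟩
  have hd : ∀ k l, AnalyticAt ℝ (fun x => c k x ^ E k - c l x ^ E l) 0 := fun k l => ((hc k).pow _).sub ((hc l).pow _)
  set A : (Fin m → ℝ) → ℝ := fun x => ∏ k ∈ Finset.range (e+1), nf (c k) x with hA
  set B : (Fin m → ℝ) → ℝ := fun x => ∏ p ∈ Finset.range (e+1) ×ˢ Finset.range (e+1), nf (fun x => c p.1 x ^ E p.1 - c p.2 x ^ E p.2) x with hB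
  have hAN : NZ A := NZ.prod _ fun k _ => nf_NZ _ (hc k)
  have hBN : NZ B := NZ.prod _ fun p _ => nf_NZ _ (hd p.1 p.2)
  obtain ⟨π, hπ, hπ0, Y, hY, hYX, hMU⟩ := LUm _ (hh.mul (hAN.mul hBN)) _ (tl_tendsto hX)
  have a1 := an_comp hπ hπ0 hh.1
  have a2 := an_comp hπ hπ0 hAN.1
  have a3 := an_comp hπ hπ0 hBN.1
  have M1 : MU (fun z => h (π z)) := MU.factor_left a1 (a2.mul a3) hMU
  have M23 : MU (fun z => A (π z) * B (π z)) := MU.factor_right a1 (a2.mul a3) hMU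
  have M2 : MU (fun z => A (π z)) := MU.factor_left a2 a3 M23
  have M3 : MU (fun z => B (π z)) := MU.factor_right a2 a3 M23
  have M2' := MU.factor_prod (Finset.range (e+1)) (F := fun k z => nf (c k) (π z))
    (fun k _ => an_comp hπ hπ0 (nf_NZ _ (hc k)).1) M2
  have M3' := MU.factor_prod (Finset.range (e+1) ×ˢ Finset.range (e+1)) (F := fun p z => nf (fun x => c p.1 x ^ E p.1 - c p.2 x ^ E p.2) (π z))
    (fun p _ => an_comp hπ hπ0 (nf_NZ _ (hd p.1 p.2)).1) M3
  have key : ∀ g, MU (fun z => nf g (π z)) → (∀ᶠ z in 𝓝 0, g (π z) = 0) ∨ MU (fun z => g (π z)) := by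
    intro g hg
    by_cases h0 : ∀ᶠ x in 𝓝 0, g x = 0
    · exact Or.inl (ev_comp hπ hπ0 h0)
    · simp only [hnf, if_neg h0] at hg; exact Or.inr hg
  refine LU.lift hπ hπ0 hYX ?_
  refine step3 e IH (h := fun z => h (π z)) M1 (c := fun k z => c k (π z)) (fun k => an_comp hπ hπ0 (hc k))
    (fun k hk => by beta_reduce; rw [hπ0]; exact hc0 k hk) (ev_comp hπ hπ0 hce)
    (fun k hk => key _ (M2' k (Finset.mem_range.2 hk)))
    (fun k hk l hl => key _ (M3' (k, l) (Finset.mem_product.2 ⟨Finset.mem_range.2 hk, Finset.mem_range.2 hl⟩)))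
    (u := fun z => u (cn (z 0) (π (tl z)))) (an_comp (lift_an hπ) (lift_zero hπ0) hu) ?_ ?_ (cn_tendsto (tendsto_pi_nhds.1 hX 0) hY)
  · have := lift_zero hπ0
    beta_reduce at this ⊢
    rw [this]; exact hu0
  · filter_upwards [ev_comp (lift_an hπ) (lift_zero hπ0) hF] with z a
    rw [a]
    simp only [tl_cn, cn_zero]

lemma Pd 
    (LUm : ∀ G : (Fin m → ℝ) → ℝ, NZ G → ∀ X : I → (Fin m → ℝ), Tendsto X U (𝓝 0) → LU U G X) (d : ℕ) :
    ∀ (h : (Fin m → ℝ) → ℝ) (Q : (Fin (m+1) → ℝ) → ℝ), NZ h → AnalyticAt ℝ Q 0 → (∃ k < d, (D0^[k] Q) 0 ≠ 0) →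
      ∀ X : I → (Fin (m+1) → ℝ), Tendsto X U (𝓝 0) → LU U (fun x => h (tl x) * Q x) X := by
  induction d with
  | zero => rintro h Q _ _ ⟨k, hk, _⟩; omega
  | succ d IH =>
    rintro h Q hh hQ ⟨k, hk, hk0⟩ X hX
    by_cases hlow : ∃ k < d, (D0^[k] Q) 0 ≠ 0
    · exact IH h Q hh hQ hlow X hX
    push Not at hlow
    have hkd : k = d := by
      by_contra hne
      exact hk0 (hlow k (by omega))
    subst hkd
    rcases k with _ | e
    · -- unit
      obtain ⟨π, hπ, hπ0, Y, hY, hYX, hMU⟩ := LUm h hh _ (tl_tendsto hX)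
      refine LU.lift hπ hπ0 hYX ?_
      refine LU.of_MU ?_ (cn_tendsto (tendsto_pi_nhds.1 hX 0) hY)
      refine MU.mul (F := fun z => h (tl (cn (z 0) (π (tl z))))) (MU.tl hMU) (MU.unit (an_comp (lift_an hπ) (lift_zero hπ0) hQ) ?_)
      have := lift_zero hπ0
      beta_reduce at this ⊢
      rw [this]; exact hk0
    · obtain ⟨τ, t1, t2, c, u, hc, hu, r1, r2, r3, r4⟩ := tsch hQ e hlow hk0
      have hY : Tendsto (fun i => cn (X i 0 - τ (tl (X i))) (tl (X i))) U (𝓝 0) := by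
        refine cn_tendsto ?_ (tl_tendsto hX)
        have t3 : Tendsto (fun i => τ (tl (X i))) U (𝓝 0) := by
          have := t1.continuousAt.tendsto
          rw [t2] at this
          exact this.comp (tl_tendsto hX)
        simpa using (tendsto_pi_nhds.1 hX 0).sub t3
      refine LU.trans (sh_an t1) (sh_zero t2) (Y := fun i => cn (X i 0 - τ (tl (X i))) (tl (X i))) ?_ ?_
      · refine Eventually.of_forall fun i => ?_
        simp only [sh, tl_cn, cn_zero, sub_add_cancel]
        exact cn_tl _
      · refine step2 e LUm IH hh hc r2 r3 hu r4 ?_ hY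
        filter_upwards [r1] with z hz
        rw [hz]
        simp only [sh, tl_cn]
end Qst
end HLD

namespace HLD
open Set Filter Topology QDC
open scoped ContDiff

section Rst
variable {I : Type*} {U : Ultrafilter I}

lemma line_exists {n : ℕ} {A : (Fin n → ℝ) → ℝ} (hA : NZ A) : ∃ x : Fin n → ℝ, ¬ ∀ᶠ s in 𝓝 (0:ℝ), A (s • x) = 0 := by
  by_contra! hcon
  obtain ⟨r, hr, hb⟩ := Metric.eventually_nhds_iff_ball.1 hA.1.eventually_analyticAt
  refine hA.2 ?_
  filter_upwards [Metric.ball_mem_nhds 0 hr] with x hx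
  set S : Set ℝ := (fun s : ℝ => s • x) ⁻¹' (Metric.ball 0 r) with hS
  have hSc : Convex ℝ S := (convex_ball (0 : Fin n → ℝ) r).linear_preimage (LinearMap.toSpanSingleton ℝ _ x)
  have han : AnalyticOnNhd ℝ (fun s : ℝ => A (s • x)) S := by
    intro s hs
    exact AnalyticAt.comp' (g := A) (f := fun s : ℝ => s • x) (hb _ hs) (analyticAt_id.smul analyticAt_const)
  have h0 : (0:ℝ) ∈ S := by simp [hS, hr]
  have h1 : (1:ℝ) ∈ S := by simpa [hS] using hx
  have := han.eqOn_zero_of_preconnected_of_eventuallyEq_zero hSc.isPreconnected h0 (hcon x) h1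
  simpa using this

theorem LU_all (n : ℕ) : ∀ G : (Fin n → ℝ) → ℝ, NZ G → ∀ X : I → (Fin n → ℝ), Tendsto X U (𝓝 0) → LU U G X := by
  induction n with
  | zero =>
    intro G hG X hX
    refine LU.of_MU (MU.unit hG.1 fun h0 => hG.2 (Eventually.of_forall fun z => ?_)) hX
    rw [Subsingleton.elim z 0, h0]
  | succ m ih =>
    intro G hG X hX
    by_cases h0 : G 0 = 0
    swap
    · exact LU.of_MU (MU.unit hG.1 h0) hX
    obtain ⟨x, hx⟩ := line_exists hG
    have hx0 : x ≠ 0 := by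
      rintro rfl
      exact hx (Eventually.of_forall fun s => by rw [smul_zero, h0])
    have hs : (Pi.single (0 : Fin (m+1)) (1:ℝ) : Fin (m+1) → ℝ) ≠ 0 := by simp
    obtain ⟨L, hL⟩ := SeparatingDual.exists_continuousLinearEquiv_apply_eq (R := ℝ) hs hx0
    have hLa : AnalyticAt ℝ (fun z => L z) 0 := (L : (Fin (m+1) → ℝ) →L[ℝ] (Fin (m+1) → ℝ)).analyticAt 0
    have hL0 : L 0 = 0 := map_zero L
    have hQ : AnalyticAt ℝ (fun z => G (L z)) 0 := an_comp hLa hL0 hG.1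
    obtain ⟨k, hk⟩ := ord_exists hQ (by
      intro hcon
      refine hx (hcon.mono fun s hs => ?_)
      have : cn s (0 : Fin m → ℝ) = s • Pi.single 0 1 := cnL_single s
      rw [this, map_smul, hL] at hs
      exact hs)
    have hY : Tendsto (fun i => L.symm (X i)) U (𝓝 0) := by
      have := L.symm.continuous.tendsto 0
      rw [map_zero] at this
      exact this.comp hX
    refine LU.trans hLa hL0 (Y := fun i => L.symm (X i)) (Eventually.of_forall fun i => by simp) ?_
    refine (Pd ih (k+1) (fun _ => 1) _ NZ.one hQ ⟨k, by omega, hk⟩ _ hY).congr ?_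
    exact Eventually.of_forall fun z => (one_mul _).symm
end Rst
end HLD

namespace HLD
open Set Filter Topology QDC
open scoped ContDiff

lemma FDV_comp {E E' : Type*} [NormedAddCommGroup E] [NormedSpace ℝ E] [NormedAddCommGroup E'] [NormedSpace ℝ E']
    {f φ : E → ℝ} {π : E' → E} {p : E'} {c : ℝ} (hπ : DifferentiableAt ℝ π p) (h : FDV f φ (π p) c) :
    FDV (fun z => f (π z)) (fun z => φ (π z)) p c := by
  intro N
  obtain ⟨g, h1, h2, h3⟩ := h N
  refine ⟨fun z => g (π z), ContinuousAt.comp (g := g) h1 hπ.continuousAt, h2, ?_⟩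
  have h4 := h3.comp_tendsto hπ.continuousAt.tendsto
  exact h4.trans ((hπ.isBigO_sub.norm_norm).pow N)

theorem GoodC {n : ℕ} {U : Set (Fin n → ℝ)} (hU : IsOpen U) {a : Fin n → ℝ} (ha : a ∈ U)
    {f φ : (Fin n → ℝ) → ℝ} (hφ : AnalyticAt ℝ φ a) (hnz : ¬ ∀ᶠ x in 𝓝 a, φ x = 0)
    (hf : ContDiffOn ℝ ∞ f U) (hd : ∀ x ∈ U, ∃ c, FDV f φ x c) {c : ℝ} (hc : FDV f φ a c) :
    Tendsto (fun x => f x / φ x) (𝓝 a ⊓ 𝓟 {x | φ x ≠ 0}) (𝓝 c) := by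
  rw [tendsto_iff_ultrafilter]
  intro V hV
  have hVa : (V : Filter _) ≤ 𝓝 a := hV.trans inf_le_left
  have hVz : ∀ᶠ x in (V : Filter _), φ x ≠ 0 := (hV.trans inf_le_right) (mem_principal_self _)
  have hXt : Tendsto (fun x : Fin n → ℝ => x - a) V (𝓝 0) := by
    have : Tendsto (fun x : Fin n → ℝ => x - a) (𝓝 a) (𝓝 (a - a)) := (continuous_id.sub continuous_const).tendsto a
    rw [sub_self] at this
    exact this.mono_left hVa
  have hadd : AnalyticAt ℝ (fun z : Fin n → ℝ => a + z) 0 := analyticAt_const.add analyticAt_id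
  have hA : NZ (fun z => φ (a + z)) := by
    refine ⟨AnalyticAt.comp' (g := φ) (by simpa using hφ) hadd, fun h => hnz ?_⟩
    have : Tendsto (fun x : Fin n → ℝ => x - a) (𝓝 a) (𝓝 0) := by
      have : Tendsto (fun x : Fin n → ℝ => x - a) (𝓝 a) (𝓝 (a - a)) := (continuous_id.sub continuous_const).tendsto a
      rwa [sub_self] at this
    filter_upwards [this.eventually h] with x hx
    simpa using hx
  obtain ⟨π, hπ, hπ0, Y, hY, hYX, β, v, hv, hv0, hmu⟩ := LU_all n _ hA _ hXt
  beta_reduce at hmu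
  have hπt : Tendsto (fun z => a + π z) (𝓝 0) (𝓝 a) := by
    have : ContinuousAt (fun z => a + π z) 0 := continuousAt_const.add hπ.continuousAt
    rw [ContinuousAt, hπ0, add_zero] at this
    exact this
  have hall : ∀ᶠ z in 𝓝 (0 : Fin n → ℝ), AnalyticAt ℝ π z ∧ AnalyticAt ℝ v z ∧ a + π z ∈ U ∧
      φ (a + π z) = v z * mono z β :=
    hπ.eventually_analyticAt.and (hv.eventually_analyticAt.and ((hπt.eventually (hU.eventually_mem ha)).and hmu))
  obtain ⟨r, hr, hball⟩ := Metric.eventually_nhds_iff_ball.1 hall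
  have hsm : ∀ y ∈ Metric.ball (0 : Fin n → ℝ) r, AnalyticAt ℝ (fun z => a + π z) y := fun y hy =>
    analyticAt_const.add (hball y hy).1
  obtain ⟨H, hH1, hH2, hH3⟩ := M2 hr β (F := fun z => f (a + π z)) (Φ := fun z => φ (a + π z)) (u := v) (c := c)
    (hf.comp (t := U) (fun y hy => (hsm y hy).contDiffAt.contDiffWithinAt) (fun y hy => (hball y hy).2.2.1))
    (fun y hy => (hball y hy).2.1.continuousAt.continuousWithinAt)
    (fun y hy => (hball y hy).2.2.2)
    (fun p hp => by
      obtain ⟨c, hc⟩ := hd _ (hball p hp).2.2.1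
      exact ⟨c, FDV_comp (hsm p hp).differentiableAt hc⟩)
    (FDV_comp (hsm 0 (Metric.mem_ball_self hr)).differentiableAt (by simpa [hπ0] using hc))
  have hlim : Tendsto (fun x => H (Y x) / v (Y x)) V (𝓝 c) := by
    have h1 := (hH1.tendsto.div hv.continuousAt.tendsto hv0).comp hY
    rw [hH2, mul_div_cancel_left₀ _ hv0] at h1
    exact h1
  refine hlim.congr' ?_
  filter_upwards [hY.eventually (Metric.ball_mem_nhds 0 hr), hYX, hVz] with x h1 h2 h3
  have e : a + π (Y x) = x := by rw [h2]; simp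
  have e1 := hH3 _ h1
  have e2 := (hball _ h1).2.2.2
  beta_reduce at e1
  rw [e] at e1 e2
  rw [e1, e2]
  rw [e2] at h3
  unfold mono at *
  have := left_ne_zero_of_mul h3
  have := right_ne_zero_of_mul h3
  field_simp

lemma dense_nz {n : ℕ} {φ : (Fin n → ℝ) → ℝ} {a : Fin n → ℝ} (hnz : ¬ ∀ᶠ x in 𝓝 a, φ x = 0) :
    (𝓝 a ⊓ 𝓟 {x | φ x ≠ 0}).NeBot := by
  rw [Filter.inf_principal_neBot_iff]
  intro s hs
  by_contra h
  apply hnz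
  filter_upwards [hs] with x hx
  by_contra h2
  exact h ⟨x, hx, h2⟩

/-- continuity of the quotient. -/
theorem C0 {n : ℕ} {W : Set (Fin n → ℝ)} (hW : IsOpen W) {f φ g : (Fin n → ℝ) → ℝ}
    (hφ : AnalyticOnNhd ℝ φ W) (hnz : ∀ a ∈ W, ¬ ∀ᶠ x in 𝓝 a, φ x = 0) (hf : ContDiffOn ℝ ∞ f W)
    (hg : ∀ a ∈ W, FDV f φ a (g a)) (hfg : ∀ a ∈ W, f a = g a * φ a) : ContinuousOn g W := by
  have key : ∀ a ∈ W, Tendsto g (𝓝 a ⊓ 𝓟 {x | φ x ≠ 0}) (𝓝 (g a)) := by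
    intro a ha
    refine (GoodC hW ha (hφ a ha) (hnz a ha) hf (fun x hx => ⟨_, hg x hx⟩) (hg a ha)).congr' ?_
    have h1 : ∀ᶠ x in 𝓝 a ⊓ 𝓟 {x | φ x ≠ 0}, x ∈ W := (inf_le_left : _ ≤ 𝓝 a) (hW.eventually_mem ha)
    have h2 : ∀ᶠ x in 𝓝 a ⊓ 𝓟 {x | φ x ≠ 0}, φ x ≠ 0 := (inf_le_right : _ ≤ 𝓟 {x | φ x ≠ 0}) (mem_principal_self _)
    filter_upwards [h1, h2] with x h3 h4
    rw [hfg x h3, mul_div_cancel_right₀ _ h4]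
  intro a ha
  apply ContinuousAt.continuousWithinAt
  rw [ContinuousAt, Metric.tendsto_nhds]
  intro ε hε
  have h1 := (Metric.tendsto_nhds.1 (key a ha)) (ε/2) (by positivity)
  rw [eventually_inf_principal] at h1
  filter_upwards [h1.eventually_nhds, hW.eventually_mem ha] with x hx hxW
  haveI := dense_nz (hnz x hxW)
  have h2 : dist (g x) (g a) ≤ ε/2 := by
    refine le_of_tendsto ((key x hxW).dist tendsto_const_nhds) ?_
    rw [eventually_inf_principal]
    filter_upwards [hx] with y hy hy2
    exact (hy hy2).le
  linarith
end HLD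

namespace HLD
open Set Filter Topology QDC
open scoped ContDiff

lemma zeros_finite {ψ : ℝ → ℝ} (hψ : AnalyticOnNhd ℝ ψ (Icc 0 1)) (h1 : ψ 1 ≠ 0) :
    {t ∈ Icc (0:ℝ) 1 | ψ t = 0}.Finite := by
  by_contra h
  obtain ⟨t, ht, hacc⟩ := Set.Infinite.exists_accPt_of_subset_isCompact h isCompact_Icc (sep_subset _ _)
  rw [accPt_iff_frequently_nhdsNE] at hacc
  have := hψ.eqOn_zero_of_preconnected_of_frequently_eq_zero isPreconnected_Icc ht (hacc.mono fun x hx => hx.2)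
  exact h1 (this (right_mem_Icc.2 zero_le_one))

theorem fd_ext {n : ℕ} {W : Set (Fin n → ℝ)} (hW : IsOpen W) {φ g : (Fin n → ℝ) → ℝ}
    {L : (Fin n → ℝ) → ((Fin n → ℝ) →L[ℝ] ℝ)}
    (hφ : AnalyticOnNhd ℝ φ W) (hnz : ∀ a ∈ W, ¬ ∀ᶠ x in 𝓝 a, φ x = 0)
    (hg : ContinuousOn g W) (hL : ContinuousOn L W)
    (hd : ∀ x ∈ W, φ x ≠ 0 → HasFDerivAt g (L x) x) : ∀ a ∈ W, HasFDerivAt g (L a) a := by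
  intro a ha
  rw [hasFDerivAt_iff_isLittleO, Asymptotics.isLittleO_iff]
  intro ε hε
  have hLc : ∀ᶠ x in 𝓝 a, ‖L x - L a‖ < ε := by
    have := Metric.tendsto_nhds.1 (hL.continuousAt (hW.mem_nhds ha)).tendsto ε hε
    simpa [dist_eq_norm] using this
  obtain ⟨r, hr, hball⟩ := Metric.eventually_nhds_iff_ball.1 (hLc.and (hW.eventually_mem ha))
  have main : ∀ x ∈ Metric.ball a r, φ x ≠ 0 → ‖g x - g a - L a (x - a)‖ ≤ ε * ‖x - a‖ := by
    intro x hx hx0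
    have hseg : ∀ t ∈ Icc (0:ℝ) 1, a + t • (x - a) ∈ Metric.ball a r := by
      intro t ht
      rw [Metric.mem_ball, dist_eq_norm] at hx ⊢
      rw [add_sub_cancel_left, norm_smul, Real.norm_of_nonneg ht.1]
      exact lt_of_le_of_lt (mul_le_of_le_one_left (norm_nonneg _) ht.2) hx
    have hlin : ∀ t : ℝ, HasDerivAt (fun t : ℝ => a + t • (x - a)) (x - a) t := by
      intro t
      have := ((hasDerivAt_id t).smul_const (x - a)).const_add a
      simpa using this
    have hcl : Continuous (fun t : ℝ => a + t • (x - a)) := by fun_prop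
    have hfin := zeros_finite (ψ := fun t => φ (a + t • (x - a))) (fun t ht =>
      AnalyticAt.comp' (g := φ) (hφ _ (hball _ (hseg t ht)).2)
        (analyticAt_const.add (analyticAt_id.smul analyticAt_const))) (by simpa using hx0)
    have hftc := MeasureTheory.integral_eq_of_hasDerivAt_off_countable_of_le
      (fun t : ℝ => g (a + t • (x - a)) - t * L a (x - a)) (fun t => (L (a + t • (x - a)) - L a) (x - a))
      zero_le_one hfin.countable
      ((hg.comp hcl.continuousOn (fun t ht => (hball _ (hseg t ht)).2)).sub (by fun_prop))
      (by
        rintro t ⟨ht, ht2⟩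
        have ht' := Ioo_subset_Icc_self ht
        have h1 := (hd _ (hball _ (hseg t ht')).2 (fun h => ht2 ⟨ht', h⟩)).comp_hasDerivAt t (hlin t)
        have h2 := h1.sub ((hasDerivAt_id t).mul_const (L a (x - a)))
        simp only [one_mul] at h2
        exact h2)
      (by
        apply ContinuousOn.intervalIntegrable
        rw [uIcc_of_le zero_le_one]
        exact ((hL.comp hcl.continuousOn (fun t ht => (hball _ (hseg t ht)).2)).sub continuousOn_const).clm_apply continuousOn_const)
    have hb := intervalIntegral.norm_integral_le_of_norm_le_const (a := (0:ℝ)) (b := 1) (C := ε * ‖x - a‖)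
      (f := fun t => (L (a + t • (x - a)) - L a) (x - a)) (by
        intro t ht
        rw [uIoc_of_le zero_le_one] at ht
        have ht' := Ioc_subset_Icc_self ht
        exact (ContinuousLinearMap.le_opNorm _ _).trans
          (mul_le_mul_of_nonneg_right (hball _ (hseg t ht')).1.le (norm_nonneg _)))
    rw [hftc] at hb
    simp only [one_smul, add_sub_cancel, one_mul, zero_smul, add_zero, zero_mul, sub_zero, abs_one, mul_one] at hb
    rwa [show g x - g a - L a (x - a) = g x - L a (x - a) - g a by ring]
  filter_upwards [Metric.ball_mem_nhds a hr] with x hx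
  haveI := dense_nz (hnz x (hball x hx).2)
  have hgx : ContinuousAt g x := hg.continuousAt (hW.mem_nhds (hball x hx).2)
  have c1 : ContinuousAt (fun x => ‖g x - g a - L a (x - a)‖) x := by fun_prop
  have c2 : ContinuousAt (fun x => ε * ‖x - a‖) x := by fun_prop
  refine le_of_tendsto_of_tendsto (c1.tendsto.mono_left inf_le_left) (c2.tendsto.mono_left inf_le_left) (b := 𝓝 x ⊓ 𝓟 {x | φ x ≠ 0}) ?_
  rw [EventuallyLE, eventually_inf_principal]
  filter_upwards [Metric.isOpen_ball.mem_nhds hx] with y hy hy2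
  exact main y hy hy2

theorem Ck {n : ℕ} {W : Set (Fin n → ℝ)} (hW : IsOpen W) (k : ℕ) :
    ∀ (f φ : (Fin n → ℝ) → ℝ) (G : (Fin n → ℝ) → MvPowerSeries (Fin n) ℝ),
    AnalyticOnNhd ℝ φ W → (∀ a ∈ W, ¬ ∀ᶠ x in 𝓝 a, φ x = 0) → ContDiffOn ℝ ∞ f W →
    (∀ a ∈ W, taylorAt f a = G a * taylorAt φ a) →
    ContDiffOn ℝ k (fun x => MvPowerSeries.coeff 0 (G x)) W := by
  have c0 : ∀ (f φ : (Fin n → ℝ) → ℝ) (G : (Fin n → ℝ) → MvPowerSeries (Fin n) ℝ) (x : Fin n → ℝ),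
      taylorAt f x = G x * taylorAt φ x → f x = MvPowerSeries.coeff 0 (G x) * φ x := by
    intro f φ G x h
    have := congrArg (MvPowerSeries.coeff 0) h
    rw [taylor_const, MvPowerSeries.coeff_zero_eq_constantCoeff, map_mul,
      ← MvPowerSeries.coeff_zero_eq_constantCoeff, taylor_const] at this
    exact this
  have cont : ∀ (f φ : (Fin n → ℝ) → ℝ) (G : (Fin n → ℝ) → MvPowerSeries (Fin n) ℝ),
    AnalyticOnNhd ℝ φ W → (∀ a ∈ W, ¬ ∀ᶠ x in 𝓝 a, φ x = 0) → ContDiffOn ℝ ∞ f W →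
    (∀ a ∈ W, taylorAt f a = G a * taylorAt φ a) →
    ContinuousOn (fun x => MvPowerSeries.coeff 0 (G x)) W := by
    intro f φ G hφ hnz hf hG
    exact C0 hW hφ hnz hf (fun a ha => FDV_of_formal hW ha hf (hφ.contDiffOn hW.uniqueDiffOn) (G a) (hG a ha))
      (fun a ha => c0 f φ G a (hG a ha))
  induction k with
  | zero =>
    intro f φ G hφ hnz hf hG
    simpa using cont f φ G hφ hnz hf hG
  | succ k ih =>
    intro f φ G hφ hnz hf hG
    have hφs : ContDiffOn ℝ ∞ φ W := hφ.contDiffOn hW.uniqueDiffOn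
    have hφ2 : AnalyticOnNhd ℝ (fun x => φ x * φ x) W := fun x hx => (hφ x hx).mul (hφ x hx)
    have hnz2 : ∀ a ∈ W, ¬ ∀ᶠ x in 𝓝 a, φ x * φ x = 0 := fun a ha h =>
      hnz a ha (h.mono fun x hx => by simpa using hx)
    have hfi : ∀ i, ContDiffOn ℝ ∞ (fun x => pd i f x * φ x + - (f x * pd i φ x)) W := fun i =>
      ((pd_smooth hW hf i).mul hφs).add (hf.mul (pd_smooth hW hφs i)).neg
    have hGi : ∀ i, ∀ a ∈ W, taylorAt (fun x => pd i f x * φ x + - (f x * pd i φ x)) a =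
        MvPowerSeries.pderiv ℝ i (G a) * taylorAt (fun x => φ x * φ x) a := by
      intro i a ha
      rw [taylor_add hW ha ((pd_smooth hW hf i).mul hφs) (hf.mul (pd_smooth hW hφs i)).neg,
        taylor_mul hW ha (pd_smooth hW hf i) hφs, taylor_const_mul hW ha (hf.mul (pd_smooth hW hφs i)),
        taylor_mul hW ha hf (pd_smooth hW hφs i), taylor_mul hW ha hφs hφs, taylor_pd hW hf ha, taylor_pd hW hφs ha,
        hG a ha, Derivation.leibniz]
      simp only [smul_eq_mul]
      ring
    set g : (Fin n → ℝ) → ℝ := fun x => MvPowerSeries.coeff 0 (G x) with hgdef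
    set gi : Fin n → (Fin n → ℝ) → ℝ := fun i x => MvPowerSeries.coeff 0 (MvPowerSeries.pderiv ℝ i (G x)) with hgidef
    have hgi : ∀ i, ContDiffOn ℝ k (gi i) W := fun i => ih _ _ _ hφ2 hnz2 (hfi i) (hGi i)
    set L : (Fin n → ℝ) → ((Fin n → ℝ) →L[ℝ] ℝ) := fun x => ∑ i, gi i x • ContinuousLinearMap.proj (R := ℝ) (φ := fun _ : Fin n => ℝ) i with hLdef
    have hLs : ContDiffOn ℝ k L W := ContDiffOn.sum fun i _ => (hgi i).smul contDiffOn_const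
    have hfd : ∀ a ∈ W, HasFDerivAt g (L a) a := by
      refine fd_ext hW hφ hnz (cont f φ G hφ hnz hf hG) hLs.continuousOn ?_
      intro x hx hx0
      have hfx := smooth_diffAt hW hf hx
      have hφx := smooth_diffAt hW hφs hx
      have hev : g =ᶠ[𝓝 x] fun y => f y * (φ y)⁻¹ := by
        filter_upwards [hW.eventually_mem hx, hφx.continuousAt.eventually_ne hx0] with y hy hy0
        rw [c0 f φ G y (hG y hy), mul_inv_cancel_right₀ hy0]
      have hgd : DifferentiableAt ℝ g x := (hfx.mul (hφx.inv hx0)).congr_of_eventuallyEq hev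
      have hfe : f =ᶠ[𝓝 x] fun y => g y * φ y := by
        filter_upwards [hW.eventually_mem hx] with y hy
        exact c0 f φ G y (hG y hy)
      refine hgd.hasFDerivAt.congr_fderiv ?_
      have hbasis : ∀ i, fderiv ℝ g x (Pi.single i 1) = gi i x := by
        intro i
        have h1 : pd i f x = g x * pd i φ x + φ x * fderiv ℝ g x (Pi.single i 1) := by
          unfold pd
          rw [hfe.fderiv_eq, fderiv_fun_mul hgd hφx]
          simp
        have h2 := c0 _ _ (fun x => MvPowerSeries.pderiv ℝ i (G x)) x (hGi i x hx)
        have h3 := c0 f φ G x (hG x hx)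
        beta_reduce at h2
        rw [h1, h3] at h2
        have h4 : (fderiv ℝ g x (Pi.single i 1) - gi i x) * (φ x * φ x) = 0 := by
          simp only [hgidef, hgdef] at h2 ⊢
          linear_combination h2
        rcases mul_eq_zero.1 h4 with h | h
        · linarith
        · simp [hx0] at h
      ext v
      have hv : v = ∑ i, v i • (Pi.single i 1 : Fin n → ℝ) := by
        ext j
        simp [Finset.sum_apply, Pi.single_apply]
      have h5 : fderiv ℝ g x v = ∑ i, v i * gi i x := by
        conv_lhs => rw [hv]
        rw [map_sum]
        refine Finset.sum_congr rfl fun i _ => ?_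
        rw [map_smul, hbasis, smul_eq_mul]
      rw [h5]
      simp [hLdef, mul_comm]
    have : ((k + 1 : ℕ) : WithTop ℕ∞) = (k : WithTop ℕ∞) + 1 := by push_cast; rfl
    rw [this, contDiffOn_succ_iff_hasFDerivWithinAt_of_uniqueDiffOn hW.uniqueDiffOn]
    exact ⟨by simp, L, hLs, fun x hx => (hfd x hx).hasFDerivWithinAt⟩
end HLD

namespace HLD
open Set Filter Topology QDC
open scoped ContDiff

theorem main_division
    {n : ℕ}
    (U : Set (Fin n → ℝ)) (hU : IsOpen U)
    (φ : (Fin n → ℝ) → ℝ) (hφ : AnalyticOnNhd ℝ φ U)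
    (f : (Fin n → ℝ) → ℝ) (hf : ContDiffOn ℝ (⊤ : ℕ∞) f U) :
    (∃ g : (Fin n → ℝ) → ℝ, ContDiffOn ℝ (⊤ : ℕ∞) g U ∧ ∀ x ∈ U, f x = g x * φ x) ↔
    (∀ a ∈ U, ∃ G : MvPowerSeries (Fin n) ℝ, taylorAt f a = G * taylorAt φ a) := by
  have hφs : ContDiffOn ℝ ∞ φ U := hφ.contDiffOn hU.uniqueDiffOn
  constructor
  · rintro ⟨g, hg, hfg⟩ a ha
    exact ⟨taylorAt g a, by
      rw [taylor_congr hU (g := fun x => g x * φ x) hfg ha, taylor_mul hU ha hg hφs]⟩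
  · intro h
    choose! G hG using h
    have hN : IsOpen {x | ∀ᶠ y in 𝓝 x, φ y = 0} := isOpen_setOf_eventually_nhds
    have hW : IsOpen {x ∈ U | ¬ ∀ᶠ y in 𝓝 x, φ y = 0} := by
      rw [isOpen_iff_mem_nhds]
      rintro a ⟨ha, hna⟩
      obtain ⟨r, hr, hb⟩ := Metric.isOpen_iff.1 hU a ha
      filter_upwards [Metric.ball_mem_nhds a hr] with x hx
      refine ⟨hb hx, fun hx0 => hna ?_⟩
      have := (hφ.mono hb).eqOn_zero_of_preconnected_of_eventuallyEq_zero
        (convex_ball a r).isPreconnected hx hx0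
      filter_upwards [Metric.ball_mem_nhds a hr] with y hy
      exact this hy
    classical
    refine ⟨fun x => if ∀ᶠ y in 𝓝 x, φ y = 0 then 0 else MvPowerSeries.coeff 0 (G x), ?_, ?_⟩
    · intro a ha
      apply ContDiffAt.contDiffWithinAt
      by_cases h0 : ∀ᶠ y in 𝓝 a, φ y = 0
      · refine (contDiffAt_const (c := (0:ℝ))).congr_of_eventuallyEq ?_
        filter_upwards [hN.eventually_mem h0] with x hx
        exact if_pos hx
      · have h1 : ContDiffOn ℝ ∞ (fun x => MvPowerSeries.coeff 0 (G x)) {x ∈ U | ¬ ∀ᶠ y in 𝓝 x, φ y = 0} := by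
          rw [contDiffOn_infty]
          intro k
          exact Ck hW k f φ G (hφ.mono (sep_subset _ _)) (fun a ha => ha.2) (hf.mono (sep_subset _ _))
            (fun a ha => hG a ha.1)
        refine (h1.contDiffAt (hW.mem_nhds ⟨ha, h0⟩)).congr_of_eventuallyEq ?_
        filter_upwards [hW.eventually_mem ⟨ha, h0⟩] with x hx
        exact if_neg hx.2
    · intro x hx
      have := congrArg (MvPowerSeries.coeff 0) (hG x hx)
      rw [taylor_const, MvPowerSeries.coeff_zero_eq_constantCoeff, map_mul,
        ← MvPowerSeries.coeff_zero_eq_constantCoeff, taylor_const] at this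
      beta_reduce
      split_ifs with h0
      · rw [this, h0.self_of_nhds]; simp
      · exact this
end HLD

namespace QDC

/-- **Hörmander–Łojasiewicz division.** A `C^∞` function is divisible by a
real-analytic function if and only if it is formally divisible at every point. -/
theorem hormander_lojasiewicz_division
    {n : ℕ}
    (U : Set (Fin n → ℝ)) (hU : IsOpen U)
    (φ : (Fin n → ℝ) → ℝ) (hφ : AnalyticOnNhd ℝ φ U)
    (f : (Fin n → ℝ) → ℝ) (hf : ContDiffOn ℝ (⊤ : ℕ∞) f U) :
    (∃ g : (Fin n → ℝ) → ℝ, ContDiffOn ℝ (⊤ : ℕ∞) g U ∧ ∀ x ∈ U, f x = g x * φ x) ↔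
    (∀ a ∈ U, ∃ G : MvPowerSeries (Fin n) ℝ, taylorAt f a = G * taylorAt φ a) := by
  exact HLD.main_division U hU φ hφ f hf

end QDC
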